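/- arXiv:1212.5768 — 2 statements merged into one kernel-verified Lean document; each statement's English description precedes it below -/
import Mathlib

section
/- Under the protocol, suppose the graph sequence G(t) is B-core-connected for some positive integer B and D = sup_{i,j,t} D(i,j,t) is finite. Then for every ε > 0 and every time t satisfying t ≥ 2^{1/(1−β)} ( 2^{2/(1−α)} ⌈32B + 8B·W(0)⌉^{1/(β−α)} + (32B·‖x(0)‖_∞)^{2/(1−α)} + 11B + (300 n³ D B)^{1/(1−β)} ) + max( (150 n³ D B · log(V2(0)/ε))^{1/(1−β)}, (8 n^{1.5}/ε)^{1/α} ), it holds that V2(x(t)) ≤ ε. -/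
open scoped Classical

noncomputable section

/-- The rounding function `R` sending `x` to `1`, `0`, `-1` according to `x > 1`,
`-1 ≤ x ≤ 1`, `x < -1`. -/
def Rq (y : ℝ) : ℝ := if y > 1 then 1 else if y < -1 then -1 else 0

/-- The data and evolution equations of the ternary-message average-consensus protocol
on `n` nodes.  `E t i j` means the edge `(i,j)` is present in the graph `G(t)`
(for `t ≥ 1`); `x t i` is the value of node `i` at time `t`; `xin t i j` is
`x̂_{i,j,in}(t)`, `xout t i j` is `x̂_{i,j,out}(t)` and `q t i j` is `q_{i→j}(t)`. -/
structure Protocol (n : ℕ) where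
  α : ℝ
  β : ℝ
  hα : 0 < α
  hαβ : α < β
  hβ : β < 1
  E : ℕ → Fin n → Fin n → Prop
  Esymm : ∀ t i j, E t i j → E t j i
  Eirrefl : ∀ t i, ¬ E t i i
  D : Fin n → Fin n → ℕ → ℝ
  Dsymm : ∀ i j t, D i j t = D j i t
  Dbound : ∀ t i j, E t i j →
    ((max (Set.ncard {k | E t i k}) (Set.ncard {k | E t j k}) : ℕ) : ℝ) ≤ D i j t
  x : ℕ → Fin n → ℝ
  xin : ℕ → Fin n → Fin n → ℝ
  xout : ℕ → Fin n → Fin n → ℝ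
  q : ℕ → Fin n → Fin n → ℝ
  hxin0 : ∀ i j, xin 0 i j = 0
  hxout0 : ∀ i j, xout 0 i j = 0
  hq : ∀ t, 1 ≤ t → ∀ i j, E t i j →
    q t i j = Rq ((t : ℝ) ^ α * (x (t - 1) i - xout (t - 1) i j))
  hxoutE : ∀ t, 1 ≤ t → ∀ i j, E t i j →
    xout t i j = xout (t - 1) i j + q t i j / (t : ℝ) ^ α
  hxinE : ∀ t, 1 ≤ t → ∀ i j, E t i j →
    xin t i j = xin (t - 1) i j + q t j i / (t : ℝ) ^ α
  hxoutN : ∀ t, 1 ≤ t → ∀ i j, ¬ E t i j → xout t i j = xout (t - 1) i j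
  hxinN : ∀ t, 1 ≤ t → ∀ i j, ¬ E t i j → xin t i j = xin (t - 1) i j
  hx : ∀ t, 1 ≤ t → ∀ i, x t i = x (t - 1) i + (1 / (t : ℝ) ^ β) *
    ∑ j ∈ Finset.univ.filter (fun j => E t i j ∧
        4 / (t : ℝ) ^ α < |xin t i j - xout t i j| ∧ q t j i = 0 ∧ q t i j = 0),
      (xin t i j - xout t i j) / (4 * D i j t)

namespace Protocol

variable {n : ℕ} (P : Protocol n)

/-- The set `S(i,t)` of neighbors that node `i` includes in its update at time `t`. -/
def S (t : ℕ) (i : Fin n) : Finset (Fin n) :=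
  Finset.univ.filter (fun j => P.E t i j ∧
    4 / (t : ℝ) ^ P.α < |P.xin t i j - P.xout t i j| ∧ P.q t j i = 0 ∧ P.q t i j = 0)

/-- The graph sequence of the protocol is `B`-core-connected with core edge
relation `Einf`: every core edge appears at some time, the graph of core edges is
connected, and every core edge appears in every time window `[kB+1, (k+1)B]`. -/
def CoreConnected (B : ℕ) (Einf : Fin n → Fin n → Prop) : Prop :=
  (∀ i j, Einf i j → ∃ t, 1 ≤ t ∧ P.E t i j) ∧
  (SimpleGraph.fromRel Einf).Connected ∧
  ∀ k : ℕ, ∀ i j, Einf i j → ∃ t, k * B + 1 ≤ t ∧ t ≤ (k + 1) * B ∧ P.E t i j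

end Protocol

/-- `M(x)`: the largest coordinate. -/
def maxV {n : ℕ} (y : Fin n → ℝ) : ℝ := ⨆ i, y i

/-- `m(x)`: the smallest coordinate. -/
def minV {n : ℕ} (y : Fin n → ℝ) : ℝ := ⨅ i, y i

/-- `W(x) = M(x) - m(x)`. -/
def Wsp {n : ℕ} (y : Fin n → ℝ) : ℝ := maxV y - minV y

/-- The sup norm `‖x‖_∞ = max_i |x_i|`. -/
def normInf {n : ℕ} (y : Fin n → ℝ) : ℝ := ⨆ i, |y i|

/-- `V2(x) = sqrt(Σ_i (x_i - (1/n) Σ_j x_j)²)`. -/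
def V2 {n : ℕ} (y : Fin n → ℝ) : ℝ :=
  Real.sqrt (∑ i, (y i - (∑ j, y j) / n) ^ 2)

section Averaging

variable {ι : Type*} [Fintype ι]

/-- One step of symmetric averaging with weights `w`. -/
def avgStep (w : ι → ι → ℝ) (y : ι → ℝ) (i : ι) : ℝ := y i + ∑ j, w i j * (y j - y i)

lemma avgStep_le_of_forall {w : ι → ι → ℝ} {y : ι → ℝ} {i : ι} {c : ℝ}
    (hw : ∀ j, 0 ≤ w i j) (hsum : ∑ j, w i j ≤ 1) (hi : y i ≤ c)
    (h : ∀ j, w i j ≠ 0 → y j ≤ c) : avgStep w y i ≤ c := by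
  have h1 : ∑ j, w i j * (y j - y i) ≤ ∑ j, w i j * (c - y i) := by
    refine Finset.sum_le_sum fun j _ => ?_
    by_cases h0 : w i j = 0
    · simp [h0]
    · exact mul_le_mul_of_nonneg_left (by linarith [h j h0]) (hw j)
  rw [← Finset.sum_mul] at h1
  unfold avgStep
  nlinarith

lemma le_avgStep_of_forall {w : ι → ι → ℝ} {y : ι → ℝ} {i : ι} {c : ℝ}
    (hw : ∀ j, 0 ≤ w i j) (hsum : ∑ j, w i j ≤ 1) (hi : c ≤ y i)
    (h : ∀ j, w i j ≠ 0 → c ≤ y j) : c ≤ avgStep w y i := by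
  have h1 : ∑ j, w i j * (c - y i) ≤ ∑ j, w i j * (y j - y i) := by
    refine Finset.sum_le_sum fun j _ => ?_
    by_cases h0 : w i j = 0
    · simp [h0]
    · exact mul_le_mul_of_nonneg_left (by linarith [h j h0]) (hw j)
  rw [← Finset.sum_mul] at h1
  unfold avgStep
  nlinarith

lemma abs_avgStep_sub_le {w : ι → ι → ℝ} {y : ι → ℝ} {i : ι} {c W : ℝ}
    (hw : ∀ j, 0 ≤ w i j) (hsum : ∑ j, w i j ≤ c) (hW : ∀ j k, y j - y k ≤ W) :
    |avgStep w y i - y i| ≤ c * W := by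
  have hW0 : 0 ≤ W := by linarith [hW i i]
  calc |avgStep w y i - y i| = |∑ j, w i j * (y j - y i)| := by simp [avgStep]
    _ ≤ ∑ j, |w i j * (y j - y i)| := Finset.abs_sum_le_sum_abs _ _
    _ ≤ ∑ j, w i j * W := by
        refine Finset.sum_le_sum fun j _ => ?_
        rw [abs_mul, abs_of_nonneg (hw j)]
        exact mul_le_mul_of_nonneg_left
          (abs_le.2 ⟨by linarith [hW i j], hW j i⟩) (hw j)
    _ = (∑ j, w i j) * W := by rw [Finset.sum_mul]
    _ ≤ c * W := mul_le_mul_of_nonneg_right hsum hW0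

lemma sum_avgStep {w : ι → ι → ℝ} (hsymm : ∀ i j, w i j = w j i) (y : ι → ℝ) :
    ∑ i, avgStep w y i = ∑ i, y i := by
  have h : ∑ i, ∑ j, w i j * (y j - y i) = ∑ i, ∑ j, w i j * (y i - y j) := by
    rw [Finset.sum_comm]
    exact Finset.sum_congr rfl fun i _ => Finset.sum_congr rfl fun j _ => by rw [hsymm j i]
  have h2 : ∑ i, ∑ j, w i j * (y i - y j) = -∑ i, ∑ j, w i j * (y j - y i) := by
    rw [← Finset.sum_neg_distrib]
    refine Finset.sum_congr rfl fun i _ => ?_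
    rw [← Finset.sum_neg_distrib]
    exact Finset.sum_congr rfl fun j _ => by ring
  simp only [avgStep, Finset.sum_add_distrib]
  linarith

lemma sum_sq_avgStep_le {w : ι → ι → ℝ} (hw : ∀ i j, 0 ≤ w i j)
    (hsymm : ∀ i j, w i j = w j i) (hsum : ∀ i, ∑ j, w i j ≤ 1 / 2) (y : ι → ℝ) :
    ∑ i, avgStep w y i ^ 2 ≤
      ∑ i, y i ^ 2 - (1 / 2) * ∑ i, ∑ j, w i j * (y j - y i) ^ 2 := by
  have hcs : ∀ i, (∑ j, w i j * (y j - y i)) ^ 2 ≤ (1 / 2) * ∑ j, w i j * (y j - y i) ^ 2 := by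
    intro i
    have h := Finset.sum_sq_le_sum_mul_sum_of_sq_le_mul Finset.univ
      (r := fun j => w i j * (y j - y i)) (f := fun j => w i j)
      (g := fun j => w i j * (y j - y i) ^ 2) (fun j _ => hw i j)
      (fun j _ => mul_nonneg (hw i j) (sq_nonneg _)) (fun j _ => le_of_eq (by ring))
    refine h.trans (mul_le_mul_of_nonneg_right (hsum i) ?_)
    exact Finset.sum_nonneg fun j _ => mul_nonneg (hw i j) (sq_nonneg _)
  have hcross : 2 * ∑ i, y i * ∑ j, w i j * (y j - y i) =
      -∑ i, ∑ j, w i j * (y j - y i) ^ 2 := by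
    have e1 : ∑ i, y i * ∑ j, w i j * (y j - y i) = ∑ i, ∑ j, w i j * (y i * (y j - y i)) := by
      refine Finset.sum_congr rfl fun i _ => ?_
      rw [Finset.mul_sum]
      exact Finset.sum_congr rfl fun j _ => by ring
    have e2 : ∑ i, ∑ j, w i j * (y i * (y j - y i)) =
        ∑ i, ∑ j, w i j * (y j * (y i - y j)) := by
      rw [Finset.sum_comm]
      exact Finset.sum_congr rfl fun i _ => Finset.sum_congr rfl fun j _ => by rw [hsymm j i]
    have e3 : ∑ i, ∑ j, w i j * (y i * (y j - y i)) + ∑ i, ∑ j, w i j * (y j * (y i - y j)) =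
        -∑ i, ∑ j, w i j * (y j - y i) ^ 2 := by
      rw [← Finset.sum_add_distrib, ← Finset.sum_neg_distrib]
      refine Finset.sum_congr rfl fun i _ => ?_
      rw [← Finset.sum_add_distrib, ← Finset.sum_neg_distrib]
      exact Finset.sum_congr rfl fun j _ => by ring
    rw [e1]; linarith
  have hexp : ∑ i, avgStep w y i ^ 2 = ∑ i, y i ^ 2 +
      2 * ∑ i, y i * ∑ j, w i j * (y j - y i) + ∑ i, (∑ j, w i j * (y j - y i)) ^ 2 := by
    rw [Finset.mul_sum, ← Finset.sum_add_distrib, ← Finset.sum_add_distrib]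
    exact Finset.sum_congr rfl fun i _ => by unfold avgStep; ring
  have h := Finset.sum_le_sum fun i (_ : i ∈ Finset.univ) => hcs i
  rw [← Finset.mul_sum] at h
  rw [hexp, hcross]
  linarith

lemma sum_sq_avgStep_le_of_edge {w : ι → ι → ℝ} (hw : ∀ i j, 0 ≤ w i j)
    (hsymm : ∀ i j, w i j = w j i) (hsum : ∀ i, ∑ j, w i j ≤ 1 / 2) (y : ι → ℝ)
    {a b : ι} (hab : a ≠ b) :
    ∑ i, avgStep w y i ^ 2 ≤ ∑ i, y i ^ 2 - w a b * (y b - y a) ^ 2 := by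
  have hnn : ∀ i j, 0 ≤ w i j * (y j - y i) ^ 2 := fun i j => mul_nonneg (hw i j) (sq_nonneg _)
  have h1 : ∑ i ∈ ({a, b} : Finset ι), ∑ j, w i j * (y j - y i) ^ 2 ≤
      ∑ i, ∑ j, w i j * (y j - y i) ^ 2 :=
    Finset.sum_le_sum_of_subset_of_nonneg (Finset.subset_univ _)
      fun i _ _ => Finset.sum_nonneg fun j _ => hnn i j
  rw [Finset.sum_pair hab] at h1
  have h2 := Finset.single_le_sum (fun j _ => hnn a j) (Finset.mem_univ b)
  have h3 := Finset.single_le_sum (fun j _ => hnn b j) (Finset.mem_univ a)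
  have h4 : w b a * (y a - y b) ^ 2 = w a b * (y b - y a) ^ 2 := by rw [hsymm b a]; ring
  linarith [sum_sq_avgStep_le hw hsymm hsum y]

end Averaging

section Spread

variable {n : ℕ}

lemma le_maxV (y : Fin n → ℝ) (i : Fin n) : y i ≤ maxV y :=
  le_ciSup (Set.finite_range y).bddAbove i

lemma minV_le (y : Fin n → ℝ) (i : Fin n) : minV y ≤ y i :=
  ciInf_le (Set.finite_range y).bddBelow i

lemma abs_le_normInf (y : Fin n → ℝ) (i : Fin n) : |y i| ≤ normInf y :=
  le_ciSup (Set.finite_range fun i => |y i|).bddAbove i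

lemma V2_nonneg (y : Fin n → ℝ) : 0 ≤ V2 y := Real.sqrt_nonneg _

lemma V2_sq (hn : 1 ≤ n) (y : Fin n → ℝ) :
    V2 y ^ 2 = ∑ i, y i ^ 2 - (∑ i, y i) ^ 2 / n := by
  have hn0 : (n : ℝ) ≠ 0 := by positivity
  rw [V2, Real.sq_sqrt (Finset.sum_nonneg fun i _ => sq_nonneg _)]
  have : ∀ i, (y i - (∑ j, y j) / n) ^ 2 =
      y i ^ 2 - 2 * ((∑ j, y j) / n) * y i + ((∑ j, y j) / n) ^ 2 := fun i => by ring
  simp only [this, Finset.sum_add_distrib, Finset.sum_sub_distrib, ← Finset.mul_sum,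
    Finset.sum_const, Finset.card_univ, Fintype.card_fin, nsmul_eq_mul]
  field_simp
  ring

lemma V2_sq_le (hn : 1 ≤ n) (y : Fin n → ℝ) : V2 y ^ 2 ≤ n * Wsp y ^ 2 := by
  have hn0 : (0 : ℝ) < n := by positivity
  rw [V2, Real.sq_sqrt (Finset.sum_nonneg fun i _ => sq_nonneg _)]
  have hlo : minV y ≤ (∑ j, y j) / n := by
    rw [le_div_iff₀ hn0]
    have := Finset.sum_le_sum fun i (_ : i ∈ Finset.univ) => minV_le y i
    simpa [mul_comm] using this
  have hhi : (∑ j, y j) / n ≤ maxV y := by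
    rw [div_le_iff₀ hn0]
    have := Finset.sum_le_sum fun i (_ : i ∈ Finset.univ) => le_maxV y i
    simpa [mul_comm] using this
  have : ∀ i, (y i - (∑ j, y j) / n) ^ 2 ≤ Wsp y ^ 2 := fun i => by
    apply sq_le_sq'
    · unfold Wsp; linarith [minV_le y i]
    · unfold Wsp; linarith [le_maxV y i]
  have h := Finset.sum_le_sum fun i (_ : i ∈ Finset.univ) => this i
  simpa using h

lemma exists_gap (hn : 1 ≤ n) (y : Fin n → ℝ) (hW : 0 < Wsp y) :
    ∃ c, (∀ i, y i ≤ c ∨ c + Wsp y / n ≤ y i) ∧ (∃ i, y i ≤ c) ∧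
      ∃ i, c + Wsp y / n ≤ y i := by
  have : Nonempty (Fin n) := ⟨⟨0, hn⟩⟩
  have hn0 : (0 : ℝ) < n := by positivity
  obtain ⟨a, ha⟩ := exists_eq_ciInf_of_finite (f := y)
  obtain ⟨b, hb⟩ := exists_eq_ciSup_of_finite (f := y)
  change y a = minV y at ha
  change y b = maxV y at hb
  set δ := Wsp y / n with hδ
  have hδ0 : 0 < δ := div_pos hW hn0
  have hnδ : n * δ = Wsp y := by rw [hδ]; field_simp
  by_cases hk : ∃ k : Fin n, ∀ i, y i ≤ minV y + k * δ ∨ minV y + k * δ + δ ≤ y i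
  · obtain ⟨k, hk⟩ := hk
    refine ⟨minV y + k * δ, hk, ⟨a, ?_⟩, ⟨b, ?_⟩⟩
    · rw [ha]
      have : 0 ≤ (k : ℝ) * δ := by positivity
      linarith
    · have h1 : ((k : ℕ) : ℝ) + 1 ≤ n := by exact_mod_cast k.2
      rw [hb]
      have : maxV y = minV y + n * δ := by rw [hnδ]; unfold Wsp; ring
      rw [this]
      nlinarith
  · push Not at hk
    choose f hf using hk
    have hinj : Function.Injective f := by
      intro k l hkl
      have h1 := hf k
      have h2 := hf l
      rw [hkl] at h1
      rcases lt_trichotomy k l with h | h | h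
      · have : ((k : ℕ) : ℝ) + 1 ≤ (l : ℕ) := by exact_mod_cast h
        nlinarith
      · exact h
      · have : ((l : ℕ) : ℝ) + 1 ≤ (k : ℕ) := by exact_mod_cast h
        nlinarith
    obtain ⟨k, hk⟩ := (Finite.surjective_of_injective hinj) a
    have h1 := (hf k).1
    rw [hk, ha] at h1
    have : 0 ≤ ((k : ℕ) : ℝ) * δ := by positivity
    linarith

end Spread

lemma Rq_eq_zero_iff (y : ℝ) : Rq y = 0 ↔ |y| ≤ 1 := by
  unfold Rq
  rw [abs_le]
  split_ifs with h1 h2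
  · constructor <;> intro h <;> [norm_num at h; linarith [h.2]]
  · constructor <;> intro h <;> [norm_num at h; linarith [h.1]]
  · exact ⟨fun _ => ⟨by linarith, by linarith⟩, fun _ => rfl⟩

lemma abs_sub_Rq_mul_div {h u : ℝ} (hh : 0 < h) (hu : 1 < |h * u|) :
    |u - Rq (h * u) / h| = |u| - 1 / h := by
  have key : ∀ v : ℝ, 1 < h * v → 0 < v ∧ 0 < v - 1 / h := fun v hv => by
    have : 1 / h < v := by rw [div_lt_iff₀ hh]; linarith
    exact ⟨by have : 0 < 1 / h := by positivity
              linarith, by linarith⟩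
  rcases lt_abs.1 hu with h1 | h1
  · obtain ⟨ha, hb⟩ := key u h1
    have : Rq (h * u) = 1 := by simp [Rq, h1]
    rw [this, abs_of_pos ha, abs_of_pos hb]
  · obtain ⟨ha, hb⟩ := key (-u) (by linarith)
    have : Rq (h * u) = -1 := by
      have h2 : ¬ 1 < h * u := by linarith
      have h3 : h * u < -1 := by linarith
      simp [Rq, h2, h3]
    rw [this, abs_of_neg (by linarith : u < 0), abs_of_neg]
    · ring
    · rw [neg_div]; linarith

lemma quantized_ratio_bounds {h a b a' b' : ℝ} (ha : |a - a'| ≤ h) (hb : |b - b'| ≤ h)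
    (hgap : 4 * h < |b' - a'|) :
    b - a ≠ 0 ∧ 2 / 3 ≤ (b' - a') / (b - a) ∧ (b' - a') / (b - a) ≤ 2 := by
  rw [abs_le] at ha hb
  rcases lt_abs.1 hgap with h1 | h1
  · have hz : 0 < b - a := by linarith
    refine ⟨hz.ne', ?_, ?_⟩
    · rw [le_div_iff₀ hz]; linarith
    · rw [div_le_iff₀ hz]; linarith
  · have hz : b - a < 0 := by linarith
    refine ⟨hz.ne, ?_, ?_⟩
    · rw [le_div_iff_of_neg hz]; linarith
    · rw [div_le_iff_of_neg hz]; linarith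

namespace Protocol

variable {n : ℕ} (P : Protocol n)

lemma xin_eq_xout (t : ℕ) (i j : Fin n) : P.xin t i j = P.xout t j i := by
  induction t generalizing i j with
  | zero => rw [P.hxin0, P.hxout0]
  | succ t ih =>
    by_cases h : P.E (t + 1) i j
    · rw [P.hxinE _ (by omega) i j h, P.hxoutE _ (by omega) j i (P.Esymm _ _ _ h)]
      simp [ih]
    · have h' : ¬ P.E (t + 1) j i := fun h' => h (P.Esymm _ _ _ h')
      rw [P.hxinN _ (by omega) i j h, P.hxoutN _ (by omega) j i h']
      simp [ih]

lemma D_pos {t : ℕ} {i j : Fin n} (h : P.E t i j) : 0 < P.D i j t := by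
  refine lt_of_lt_of_le ?_ (P.Dbound t i j h)
  have : 0 < Set.ncard {k | P.E t i k} := (Set.ncard_pos (Set.toFinite _)).2 ⟨j, h⟩
  exact_mod_cast lt_max_of_lt_left this

lemma abs_le_of_q_eq_zero {t : ℕ} (ht : 1 ≤ t) {i j : Fin n} (hE : P.E t i j)
    (hq : P.q t i j = 0) : |P.x (t - 1) i - P.xout (t - 1) i j| ≤ 1 / (t : ℝ) ^ P.α := by
  have hpos : (0 : ℝ) < (t : ℝ) ^ P.α := by positivity
  rw [P.hq t ht i j hE, Rq_eq_zero_iff, abs_mul, abs_of_pos hpos] at hq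
  rw [le_div_iff₀ hpos]; linarith

lemma xout_eq_of_q_eq_zero {t : ℕ} (ht : 1 ≤ t) {i j : Fin n} (hE : P.E t i j)
    (hq : P.q t i j = 0) : P.xout t i j = P.xout (t - 1) i j := by
  rw [P.hxoutE t ht i j hE, hq]; simp

/-- The averaging weight that the update at time `t` puts on the ordered pair `(i,j)`. -/
def weight (t : ℕ) (i j : Fin n) : ℝ :=
  if j ∈ P.S t i then
    1 / (t : ℝ) ^ P.β * ((P.xin t i j - P.xout t i j) / (4 * P.D i j t)) /
      (P.x (t - 1) j - P.x (t - 1) i)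
  else 0

lemma mem_S {t : ℕ} {i j : Fin n} : j ∈ P.S t i ↔ P.E t i j ∧
    4 / (t : ℝ) ^ P.α < |P.xin t i j - P.xout t i j| ∧ P.q t j i = 0 ∧ P.q t i j = 0 := by
  simp [S]

lemma mem_S_symm {t : ℕ} {i j : Fin n} (h : j ∈ P.S t i) : i ∈ P.S t j := by
  rw [mem_S] at h ⊢
  refine ⟨P.Esymm _ _ _ h.1, ?_, h.2.2.2, h.2.2.1⟩
  rw [P.xin_eq_xout t j i, ← P.xin_eq_xout t i j, abs_sub_comm]
  exact h.2.1

lemma weight_symm (t : ℕ) (i j : Fin n) : P.weight t i j = P.weight t j i := by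
  by_cases h : j ∈ P.S t i
  · have h' := P.mem_S_symm h
    rw [weight, weight, if_pos h, if_pos h', P.xin_eq_xout t j i, ← P.xin_eq_xout t i j,
      P.Dsymm j i t, ← neg_sub (P.x (t - 1) j) (P.x (t - 1) i),
      ← neg_sub (P.xin t i j) (P.xout t i j)]
    rw [neg_div, mul_neg, neg_div_neg_eq]
  · have h' : i ∉ P.S t j := fun h' => h (P.mem_S_symm h')
    rw [weight, weight, if_neg h, if_neg h']

lemma ratio_bounds {t : ℕ} (ht : 1 ≤ t) {i j : Fin n} (h : j ∈ P.S t i) :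
    P.x (t - 1) j - P.x (t - 1) i ≠ 0 ∧
      2 / 3 ≤ (P.xin t i j - P.xout t i j) / (P.x (t - 1) j - P.x (t - 1) i) ∧
      (P.xin t i j - P.xout t i j) / (P.x (t - 1) j - P.x (t - 1) i) ≤ 2 := by
  obtain ⟨hE, hgap, hq1, hq2⟩ := P.mem_S.1 h
  have hE' := P.Esymm _ _ _ hE
  refine quantized_ratio_bounds (h := 1 / (t : ℝ) ^ P.α) ?_ ?_ (by simpa [div_eq_mul_inv] using hgap)
  · rw [P.xout_eq_of_q_eq_zero ht hE hq2]
    exact P.abs_le_of_q_eq_zero ht hE hq2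
  · rw [P.xin_eq_xout, P.xout_eq_of_q_eq_zero ht hE' hq1]
    exact P.abs_le_of_q_eq_zero ht hE' hq1

lemma weight_bounds {t : ℕ} (ht : 1 ≤ t) {i j : Fin n} (h : j ∈ P.S t i) :
    1 / (6 * P.D i j t * (t : ℝ) ^ P.β) ≤ P.weight t i j ∧
      P.weight t i j ≤ 1 / (2 * P.D i j t * (t : ℝ) ^ P.β) := by
  obtain ⟨h0, h1, h2⟩ := P.ratio_bounds ht h
  have hD := P.D_pos (P.mem_S.1 h).1
  have hβ : (0 : ℝ) < (t : ℝ) ^ P.β := by positivity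
  set r := (P.xin t i j - P.xout t i j) / (P.x (t - 1) j - P.x (t - 1) i) with hr
  have e : P.weight t i j = r / (4 * P.D i j t * (t : ℝ) ^ P.β) := by
    rw [weight, if_pos h, hr]; field_simp
  rw [e]
  constructor
  · rw [div_le_div_iff₀ (by positivity) (by positivity)]
    nlinarith [mul_pos hD hβ]
  · rw [div_le_div_iff₀ (by positivity) (by positivity)]
    nlinarith [mul_pos hD hβ]

lemma weight_nonneg {t : ℕ} (ht : 1 ≤ t) (i j : Fin n) : 0 ≤ P.weight t i j := by
  by_cases h : j ∈ P.S t i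
  · have hD := P.D_pos (P.mem_S.1 h).1
    exact le_trans (by positivity) (P.weight_bounds ht h).1
  · rw [weight, if_neg h]

lemma mem_S_of_weight_ne_zero {t : ℕ} {i j : Fin n} (h : P.weight t i j ≠ 0) : j ∈ P.S t i := by
  by_contra h'
  exact h (by rw [weight, if_neg h'])

lemma sum_weight_le {t : ℕ} (ht : 1 ≤ t) (i : Fin n) :
    ∑ j, P.weight t i j ≤ 1 / 2 * (1 / (t : ℝ) ^ P.β) := by
  have hβ : (0 : ℝ) < (t : ℝ) ^ P.β := by positivity
  set N := Finset.univ.filter (fun k => P.E t i k) with hN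
  have hcard : Set.ncard {k | P.E t i k} = N.card := by
    rw [← Set.ncard_coe_finset]; congr 1; ext; simp [hN]
  have h1 : ∑ j, P.weight t i j ≤ ∑ j ∈ N, 1 / 2 * (1 / (t : ℝ) ^ P.β) * (1 / (N.card : ℝ)) := by
    rw [Finset.sum_filter]
    refine Finset.sum_le_sum fun j _ => ?_
    by_cases h : j ∈ P.S t i
    · have hE := (P.mem_S.1 h).1
      have hNpos : 0 < N.card := Finset.card_pos.2 ⟨j, by simp [hN, hE]⟩
      have hN' : (0 : ℝ) < N.card := by exact_mod_cast hNpos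
      have hD : (N.card : ℝ) ≤ P.D i j t := by
        refine le_trans ?_ (P.Dbound t i j hE)
        rw [← hcard]
        exact_mod_cast le_max_left _ _
      rw [if_pos hE]
      refine (P.weight_bounds ht h).2.trans ?_
      rw [← one_div_mul_one_div, ← one_div_mul_one_div, mul_assoc, mul_comm (1 / P.D i j t),
        ← mul_assoc]
      gcongr
    · rw [weight, if_neg h]
      split_ifs <;> positivity
  refine h1.trans ?_
  rw [Finset.sum_const, nsmul_eq_mul]
  by_cases h0 : N.card = 0
  · rw [h0]; simp only [Nat.cast_zero, zero_mul]; positivity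
  · have : (N.card : ℝ) ≠ 0 := by exact_mod_cast h0
    field_simp
    exact le_rfl

lemma x_eq_avgStep {t : ℕ} (ht : 1 ≤ t) :
    P.x t = avgStep (P.weight t) (P.x (t - 1)) := by
  funext i
  rw [P.hx t ht i, avgStep, Finset.mul_sum]
  congr 1
  rw [Finset.sum_filter]
  refine Finset.sum_congr rfl fun j _ => ?_
  by_cases h : j ∈ P.S t i
  · have h0 := (P.ratio_bounds ht h).1
    rw [if_pos (P.mem_S.1 h), weight, if_pos h, div_mul_cancel₀ _ h0]
  · rw [if_neg (fun h' => h (P.mem_S.2 h')), weight, if_neg h, zero_mul]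

lemma sum_weight_le_half {t : ℕ} (ht : 1 ≤ t) (i : Fin n) : ∑ j, P.weight t i j ≤ 1 / 2 := by
  refine (P.sum_weight_le ht i).trans ?_
  have h1 : (1 : ℝ) ≤ (t : ℝ) ^ P.β :=
    Real.one_le_rpow (by exact_mod_cast ht) (P.hα.trans P.hαβ).le
  have : 1 / (t : ℝ) ^ P.β ≤ 1 := by rw [div_le_one (by linarith)]; exact h1
  linarith

lemma x_le_maxV (t : ℕ) (i : Fin n) : P.x t i ≤ maxV (P.x 0) := by
  induction t generalizing i with
  | zero => exact le_maxV _ i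
  | succ t ih =>
    rw [P.x_eq_avgStep (t := t + 1) (by omega)]
    exact avgStep_le_of_forall (P.weight_nonneg (by omega) i)
      ((P.sum_weight_le_half (by omega) i).trans (by norm_num)) (ih i) fun j _ => ih j

lemma minV_le_x (t : ℕ) (i : Fin n) : minV (P.x 0) ≤ P.x t i := by
  induction t generalizing i with
  | zero => exact minV_le _ i
  | succ t ih =>
    rw [P.x_eq_avgStep (t := t + 1) (by omega)]
    exact le_avgStep_of_forall (P.weight_nonneg (by omega) i)
      ((P.sum_weight_le_half (by omega) i).trans (by norm_num)) (ih i) fun j _ => ih j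

lemma abs_x_le (t : ℕ) (i : Fin n) : |P.x t i| ≤ normInf (P.x 0) := by
  induction t generalizing i with
  | zero => exact abs_le_normInf _ i
  | succ t ih =>
    rw [P.x_eq_avgStep (t := t + 1) (by omega), abs_le]
    have hw := P.weight_nonneg (t := t + 1) (by omega) i
    have hs := (P.sum_weight_le_half (t := t + 1) (by omega) i).trans (by norm_num : (1 : ℝ) / 2 ≤ 1)
    exact ⟨le_avgStep_of_forall hw hs (abs_le.1 (ih i)).1
        fun j _ => (abs_le.1 (ih j)).1,
      avgStep_le_of_forall (P.weight_nonneg (by omega) i) hs (abs_le.1 (ih i)).2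
        fun j _ => (abs_le.1 (ih j)).2⟩

lemma abs_x_sub_le {t : ℕ} (ht : 1 ≤ t) (i : Fin n) :
    |P.x t i - P.x (t - 1) i| ≤ 1 / 2 * (1 / (t : ℝ) ^ P.β) * Wsp (P.x 0) := by
  rw [P.x_eq_avgStep ht]
  refine abs_avgStep_sub_le (P.weight_nonneg ht i) (P.sum_weight_le ht i) fun j k => ?_
  have h1 := P.x_le_maxV (t - 1) j
  have h2 := P.minV_le_x (t - 1) k
  unfold Wsp; linarith

lemma V2_sq_succ_le (hn : 1 ≤ n) {t : ℕ} (ht : 1 ≤ t) {a b : Fin n} (hab : a ≠ b) :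
    V2 (P.x t) ^ 2 ≤ V2 (P.x (t - 1)) ^ 2 -
      P.weight t a b * (P.x (t - 1) b - P.x (t - 1) a) ^ 2 := by
  rw [V2_sq hn, V2_sq hn, P.x_eq_avgStep ht, sum_avgStep (P.weight_symm t)]
  have := sum_sq_avgStep_le_of_edge (P.weight_nonneg ht) (P.weight_symm t)
    (P.sum_weight_le_half ht) (P.x (t - 1)) hab
  linarith

lemma V2_succ_le (hn : 1 ≤ n) {t : ℕ} (ht : 1 ≤ t) : V2 (P.x t) ≤ V2 (P.x (t - 1)) := by
  refine le_of_sq_le_sq ?_ (V2_nonneg _)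
  rw [V2_sq hn, V2_sq hn, P.x_eq_avgStep ht, sum_avgStep (P.weight_symm t)]
  have := sum_sq_avgStep_le (P.weight_nonneg ht) (P.weight_symm t)
    (P.sum_weight_le_half ht) (P.x (t - 1))
  have h2 : 0 ≤ ∑ i, ∑ j, P.weight t i j * (P.x (t - 1) j - P.x (t - 1) i) ^ 2 :=
    Finset.sum_nonneg fun i _ => Finset.sum_nonneg fun j _ =>
      mul_nonneg (P.weight_nonneg ht i j) (sq_nonneg _)
  linarith

lemma V2_antitone (hn : 1 ≤ n) : Antitone fun t => V2 (P.x t) :=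
  antitone_nat_of_succ_le fun t => P.V2_succ_le hn (t := t + 1) (by omega)

end Protocol

namespace Protocol

variable {n : ℕ} (P : Protocol n)

lemma gap_preserved {s : ℕ} {c d : ℝ} (hcd : ∀ i, P.x s i ≤ c ∨ d ≤ P.x s i) (k : ℕ)
    (h : ∀ l < k, ∀ i j, P.x s i ≤ c → d ≤ P.x s j → j ∉ P.S (s + l + 1) i) (i : Fin n) :
    (P.x s i ≤ c → P.x (s + k) i ≤ c) ∧ (d ≤ P.x s i → d ≤ P.x (s + k) i) := by
  induction k generalizing i with
  | zero => simp
  | succ k ih =>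
    have ih' := ih fun l hl => h l (by omega)
    have hw := P.weight_nonneg (t := s + k + 1) (by omega)
    have hs := (P.sum_weight_le_half (t := s + k + 1) (by omega) i).trans
      (by norm_num : (1 : ℝ) / 2 ≤ 1)
    rw [← add_assoc, P.x_eq_avgStep (t := s + k + 1) (by omega), Nat.add_sub_cancel]
    constructor
    · intro hi
      refine avgStep_le_of_forall (hw i) hs ((ih' i).1 hi) fun j hj => ?_
      rcases hcd j with hj' | hj'
      · exact (ih' j).1 hj'
      · exact absurd (P.mem_S_of_weight_ne_zero hj) (h k (by omega) i j hi hj')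
    · intro hi
      refine le_avgStep_of_forall (hw i) hs ((ih' i).2 hi) fun j hj => ?_
      rcases hcd j with hj' | hj'
      · exact absurd (P.mem_S_symm (P.mem_S_of_weight_ne_zero hj)) (h k (by omega) j i hj' hi)
      · exact (ih' j).2 hj'

lemma mem_S_of_large_gap {t : ℕ} (ht : 1 ≤ t) {i j : Fin n} (hE : P.E t i j)
    (hq : P.q t i j = 0) (hq' : P.q t j i = 0)
    (hgap : 6 / (t : ℝ) ^ P.α < P.x (t - 1) j - P.x (t - 1) i) : j ∈ P.S t i := by
  have hE' := P.Esymm _ _ _ hE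
  refine P.mem_S.2 ⟨hE, ?_, hq', hq⟩
  have h1 := abs_le.1 (P.abs_le_of_q_eq_zero ht hE hq)
  have h2 := abs_le.1 (P.abs_le_of_q_eq_zero ht hE' hq')
  rw [P.xin_eq_xout, P.xout_eq_of_q_eq_zero ht hE hq, P.xout_eq_of_q_eq_zero ht hE' hq']
  refine lt_of_lt_of_le ?_ (le_abs_self _)
  have e : ∀ a : ℝ, a / (t : ℝ) ^ P.α = a * (1 / (t : ℝ) ^ P.α) := fun a => by ring
  rw [e] at hgap ⊢
  linarith [h1.2, h2.1]

/-- Every core edge is quiet (neither endpoint sends a correction) at some time in `(s, s + L]`. -/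
def QuietWindow (Einf : Fin n → Fin n → Prop) (s L : ℕ) : Prop :=
  ∀ i j, Einf i j → ∃ τ, s < τ ∧ τ ≤ s + L ∧ P.E τ i j ∧ P.q τ i j = 0 ∧ P.q τ j i = 0

lemma exists_crossing {Einf : Fin n → Fin n → Prop}
    (hconn : (SimpleGraph.fromRel Einf).Connected) {s L : ℕ} (hs : 1 ≤ s)
    (hquiet : P.QuietWindow Einf s L) {c d : ℝ}
    (hcd : ∀ i, P.x s i ≤ c ∨ d ≤ P.x s i) (hgap : 6 / (s : ℝ) ^ P.α < d - c)
    (hlow : ∃ i, P.x s i ≤ c) (hhigh : ∃ i, d ≤ P.x s i) :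
    ∃ l < L, ∃ i j, P.x s i ≤ c ∧ d ≤ P.x s j ∧ j ∈ P.S (s + l + 1) i := by
  by_contra! hno
  have hcd' : c < d := by
    have : 0 ≤ 6 / (s : ℝ) ^ P.α := by positivity
    linarith
  obtain ⟨a, ha⟩ := hlow
  obtain ⟨b, hb⟩ := hhigh
  obtain ⟨p⟩ := hconn.preconnected a b
  obtain ⟨e, -, he1, he2⟩ := p.exists_boundary_dart {i | P.x s i ≤ c} ha
    (by simp only [Set.mem_ofPred_eq, not_le]; linarith)
  have hadj := e.adj
  set i := e.fst
  set j := e.snd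
  have hi : P.x s i ≤ c := he1
  have hj : d ≤ P.x s j := (hcd j).resolve_left he2
  have hq : ∃ τ, s < τ ∧ τ ≤ s + L ∧ P.E τ i j ∧ P.q τ i j = 0 ∧ P.q τ j i = 0 := by
    rw [SimpleGraph.fromRel_adj] at hadj
    rcases hadj.2 with h | h
    · exact hquiet i j h
    · obtain ⟨τ, h1, h2, h3, h4, h5⟩ := hquiet j i h
      exact ⟨τ, h1, h2, P.Esymm _ _ _ h3, h5, h4⟩
  obtain ⟨τ, h1, h2, hE, hq1, hq2⟩ := hq
  obtain ⟨l, rfl⟩ : ∃ l, τ = s + l + 1 := ⟨τ - s - 1, by omega⟩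
  have hpres := P.gap_preserved hcd l fun m hm => hno m (by omega)
  refine hno l (by omega) i j hi hj (P.mem_S_of_large_gap (by omega) hE hq1 hq2 ?_)
  rw [Nat.add_sub_cancel]
  have h3 := (hpres i).1 hi
  have h4 := (hpres j).2 hj
  have h5 : 6 / ((s + l + 1 : ℕ) : ℝ) ^ P.α ≤ 6 / (s : ℝ) ^ P.α := by
    have hs' : (0 : ℝ) < s := by exact_mod_cast hs
    have := P.hα.le
    gcongr
  linarith

lemma V2_sq_window_le (hn : 1 ≤ n) {Einf : Fin n → Fin n → Prop}
    (hconn : (SimpleGraph.fromRel Einf).Connected) {s L : ℕ} (hs : 1 ≤ s)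
    (hquiet : P.QuietWindow Einf s L) {Dsup : ℝ}
    (hDsup : ∀ t i j, P.E t i j → P.D i j t ≤ Dsup)
    (hgap : 6 / (s : ℝ) ^ P.α < Wsp (P.x s) / n) :
    V2 (P.x (s + L)) ^ 2 ≤ V2 (P.x s) ^ 2 -
      1 / (6 * Dsup * ((s + L : ℕ) : ℝ) ^ P.β) * (Wsp (P.x s) / n) ^ 2 := by
  have hn0 : (0 : ℝ) < n := by positivity
  have hδ : 0 < Wsp (P.x s) / n := lt_of_le_of_lt (by positivity) hgap
  have hW : 0 < Wsp (P.x s) := by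
    by_contra! h
    exact absurd hδ (not_lt.2 (div_nonpos_of_nonpos_of_nonneg h hn0.le))
  obtain ⟨c, hcd, hlow, hhigh⟩ := exists_gap hn (P.x s) hW
  set δ := Wsp (P.x s) / n
  have hex := P.exists_crossing hconn hs hquiet hcd (by linarith) hlow hhigh
  have hl := Nat.find_spec hex
  have hmin := fun m => Nat.find_min hex (m := m)
  set l := Nat.find hex
  obtain ⟨hlL, i, j, hi, hj, hS⟩ := hl
  have hpres := P.gap_preserved hcd l fun m hm i j hi hj hS =>
    hmin m hm ⟨by omega, i, j, hi, hj, hS⟩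
  have h3 := (hpres i).1 hi
  have h4 := (hpres j).2 hj
  have hne : i ≠ j := by rintro rfl; linarith
  have hstep := P.V2_sq_succ_le hn (t := s + l + 1) (by omega) hne
  rw [Nat.add_sub_cancel] at hstep
  have hE := (P.mem_S.1 hS).1
  have hD := P.D_pos hE
  have hw := (P.weight_bounds (by omega) hS).1
  have hw' : 1 / (6 * Dsup * ((s + L : ℕ) : ℝ) ^ P.β) ≤ P.weight (s + l + 1) i j := by
    refine le_trans ?_ hw
    have h1 := hDsup _ _ _ hE
    have h0 := hD.trans_le h1
    have h2 : ((s + l + 1 : ℕ) : ℝ) ^ P.β ≤ ((s + L : ℕ) : ℝ) ^ P.β :=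
      Real.rpow_le_rpow (by positivity) (by exact_mod_cast (by omega : s + l + 1 ≤ s + L))
        (P.hα.trans P.hαβ).le
    gcongr
  have hsq : δ ^ 2 ≤ (P.x (s + l) j - P.x (s + l) i) ^ 2 := by
    apply pow_le_pow_left₀ hδ.le; linarith
  have hprod := mul_le_mul hw' hsq (sq_nonneg _) (P.weight_nonneg (by omega) i j)
  have hV1 : V2 (P.x (s + l)) ^ 2 ≤ V2 (P.x s) ^ 2 :=
    pow_le_pow_left₀ (V2_nonneg _) (P.V2_antitone hn (by omega : s ≤ s + l)) 2
  have hV2 : V2 (P.x (s + L)) ^ 2 ≤ V2 (P.x (s + l + 1)) ^ 2 :=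
    pow_le_pow_left₀ (V2_nonneg _) (P.V2_antitone hn (by omega : s + l + 1 ≤ s + L)) 2
  linarith

lemma V2_window_le (hn : 1 ≤ n) {Einf : Fin n → Fin n → Prop}
    (hconn : (SimpleGraph.fromRel Einf).Connected) {s L : ℕ} (hs : 1 ≤ s)
    (hquiet : P.QuietWindow Einf s L) {Dsup : ℝ} (hD : 0 < Dsup)
    (hDsup : ∀ t i j, P.E t i j → P.D i j t ≤ Dsup)
    (hV : 6 * (n : ℝ) ^ (1.5 : ℝ) / (s : ℝ) ^ P.α < V2 (P.x s)) :
    V2 (P.x (s + L)) ≤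
      V2 (P.x s) * (1 - 1 / (12 * (n : ℝ) ^ 3 * Dsup) * (1 / ((s + L : ℕ) : ℝ) ^ P.β)) := by
  have hn0 : (0 : ℝ) < n := by positivity
  have hn1 : (1 : ℝ) ≤ n := by exact_mod_cast hn
  have hW0 : 0 ≤ Wsp (P.x s) := by
    have i : Fin n := ⟨0, hn⟩
    unfold Wsp; linarith [minV_le (P.x s) i, le_maxV (P.x s) i]
  have hVW := V2_sq_le hn (P.x s)
  have hn15 : ((n : ℝ) ^ (1.5 : ℝ)) ^ 2 = (n : ℝ) ^ 3 := by
    rw [← Real.rpow_natCast, ← Real.rpow_mul hn0.le, ← Real.rpow_natCast]; norm_num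
  have hgap : 6 / (s : ℝ) ^ P.α < Wsp (P.x s) / n := by
    refine lt_of_pow_lt_pow_left₀ 2 (by positivity) ?_
    have h1 : (6 * (n : ℝ) ^ (1.5 : ℝ) / (s : ℝ) ^ P.α) ^ 2 < n * Wsp (P.x s) ^ 2 :=
      lt_of_lt_of_le (pow_lt_pow_left₀ hV (by positivity) two_ne_zero) hVW
    have h2 : (6 * (n : ℝ) ^ (1.5 : ℝ) / (s : ℝ) ^ P.α) ^ 2 =
        (n : ℝ) ^ 3 * (6 / (s : ℝ) ^ P.α) ^ 2 := by
      rw [← hn15]; ring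
    have h3 : (n : ℝ) * Wsp (P.x s) ^ 2 = (n : ℝ) ^ 3 * (Wsp (P.x s) / n) ^ 2 := by
      field_simp
    rw [h2, h3] at h1
    exact lt_of_mul_lt_mul_left h1 (by positivity)
  have hdec := P.V2_sq_window_le hn hconn hs hquiet hDsup hgap
  have hsL : (1 : ℝ) ≤ ((s + L : ℕ) : ℝ) ^ P.β :=
    Real.one_le_rpow (by exact_mod_cast (by omega : 1 ≤ s + L)) (P.hα.trans P.hαβ).le
  set b := ((s + L : ℕ) : ℝ) ^ P.β
  set v := V2 (P.x s)
  have hv : 0 < v := lt_of_le_of_lt (by positivity) hV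
  have h4 : v ^ 2 / (n : ℝ) ^ 3 ≤ (Wsp (P.x s) / n) ^ 2 := by
    rw [div_le_iff₀ (by positivity)]
    refine hVW.trans (le_of_eq ?_)
    field_simp
  set r := 1 / (12 * (n : ℝ) ^ 3 * Dsup) * (1 / b) with hr
  have h5 : V2 (P.x (s + L)) ^ 2 ≤ v ^ 2 * (1 - 2 * r) := by
    have h6 : 1 / (6 * Dsup * b) * (v ^ 2 / (n : ℝ) ^ 3) ≤
        1 / (6 * Dsup * b) * (Wsp (P.x s) / n) ^ 2 :=
      mul_le_mul_of_nonneg_left h4 (by positivity)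
    have h7 : 1 / (6 * Dsup * b) * (v ^ 2 / (n : ℝ) ^ 3) = v ^ 2 * (2 * r) := by
      rw [hr]; field_simp; norm_num
    linarith
  have h6 : 0 ≤ 1 - 2 * r := by
    by_contra! h
    nlinarith [sq_nonneg (V2 (P.x (s + L))), mul_pos hv hv]
  refine le_of_sq_le_sq ?_ (mul_nonneg hv.le ?_)
  · nlinarith [mul_nonneg (sq_nonneg v) (sq_nonneg r)]
  · have : 0 ≤ r := by positivity
    linarith

end Protocol

section Rpow

lemma inv_rpow_le_mul {a s s' c : ℝ} (ha1 : a ≤ 1) (hs : 0 < s) (hss' : s ≤ s')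
    (hc : s' ≤ c * s) : 1 / s ^ a ≤ c * (1 / s' ^ a) := by
  have hs' : 0 < s' := hs.trans_le hss'
  have h1 : (s' / s) ^ a ≤ s' / s := by
    have := Real.rpow_le_rpow_of_exponent_le ((one_le_div hs).2 hss') ha1
    rwa [Real.rpow_one] at this
  have h2 : s' / s ≤ c := by rw [div_le_iff₀ hs]; exact hc
  rw [Real.div_rpow hs'.le hs.le] at h1
  have h3 := h1.trans h2
  have p1 : 0 < s ^ a := by positivity
  have p2 : 0 < s' ^ a := by positivity
  rw [div_le_iff₀ p1] at h3
  rw [mul_one_div, div_le_div_iff₀ p1 p2]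
  linarith

lemma add_rpow_one_sub_le {a s L : ℝ} (ha : 0 ≤ a) (hs : 0 < s) (hL : 0 ≤ L) :
    (s + L) ^ (1 - a) ≤ s ^ (1 - a) + L * (1 / s ^ a) := by
  rw [Real.rpow_sub (by linarith), Real.rpow_sub hs, Real.rpow_one, Real.rpow_one, mul_one_div,
    ← add_div]
  gcongr
  linarith

end Rpow

namespace Protocol

variable {n : ℕ} (P : Protocol n)

/-- The error of the estimate of `x i` shared on the edge `(i,j)`. -/
def err (i j : Fin n) (t : ℕ) : ℝ := |P.x t i - P.xout t i j|

lemma err_nonneg (i j : Fin n) (t : ℕ) : 0 ≤ P.err i j t := abs_nonneg _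

lemma lt_err_of_q_ne_zero {t : ℕ} (ht : 1 ≤ t) {i j : Fin n} (hE : P.E t i j)
    (hq : P.q t i j ≠ 0) : 1 / (t : ℝ) ^ P.α < P.err i j (t - 1) := by
  have hpos : (0 : ℝ) < (t : ℝ) ^ P.α := by positivity
  rw [P.hq t ht i j hE, Ne, Rq_eq_zero_iff, not_le, abs_mul, abs_of_pos hpos] at hq
  rw [err, div_lt_iff₀ hpos]; linarith

lemma abs_sub_xout_of_q_ne_zero {t : ℕ} (ht : 1 ≤ t) {i j : Fin n} (hE : P.E t i j)
    (hq : P.q t i j ≠ 0) :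
    |P.x (t - 1) i - P.xout t i j| = P.err i j (t - 1) - 1 / (t : ℝ) ^ P.α := by
  have hpos : (0 : ℝ) < (t : ℝ) ^ P.α := by positivity
  have hq' := hq
  rw [P.hq t ht i j hE, Ne, Rq_eq_zero_iff, not_le] at hq'
  rw [P.hxoutE t ht i j hE, P.hq t ht i j hE, ← sub_sub, abs_sub_Rq_mul_div hpos hq', err]

lemma err_le_sub {t : ℕ} (ht : 1 ≤ t) {i j : Fin n} (hE : P.E t i j) (hq : P.q t i j ≠ 0) :
    P.err i j t ≤ P.err i j (t - 1) - 1 / (t : ℝ) ^ P.α + |P.x t i - P.x (t - 1) i| := by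
  have h := abs_add_le (P.x t i - P.x (t - 1) i) (P.x (t - 1) i - P.xout t i j)
  rw [P.abs_sub_xout_of_q_ne_zero ht hE hq] at h
  have e : P.x t i - P.x (t - 1) i + (P.x (t - 1) i - P.xout t i j) =
      P.x t i - P.xout t i j := by ring
  rw [e] at h
  unfold err at h ⊢
  linarith

lemma err_le_add {t : ℕ} (ht : 1 ≤ t) (i j : Fin n) :
    P.err i j t ≤ P.err i j (t - 1) + |P.x t i - P.x (t - 1) i| := by
  by_cases h : P.E t i j ∧ P.q t i j ≠ 0
  · have h1 := P.err_le_sub ht h.1 h.2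
    have : 0 ≤ 1 / (t : ℝ) ^ P.α := by positivity
    linarith
  · have hx : P.xout t i j = P.xout (t - 1) i j := by
      by_cases hE : P.E t i j
      · exact P.xout_eq_of_q_eq_zero ht hE (by by_contra hq; exact h ⟨hE, hq⟩)
      · exact P.hxoutN t ht i j hE
    have h := abs_add_le (P.x t i - P.x (t - 1) i) (P.x (t - 1) i - P.xout (t - 1) i j)
    have e : P.x t i - P.x (t - 1) i + (P.x (t - 1) i - P.xout (t - 1) i j) =
        P.x t i - P.xout t i j := by rw [hx]; ring
    rw [e] at h
    unfold err
    linarith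

lemma abs_xout_le (t : ℕ) (i j : Fin n) : |P.xout t i j| ≤ normInf (P.x 0) := by
  induction t with
  | zero =>
    rw [P.hxout0, abs_zero]
    exact (abs_nonneg _).trans (abs_le_normInf (P.x 0) i)
  | succ t ih =>
    have ht : 1 ≤ t + 1 := by omega
    by_cases hE : P.E (t + 1) i j
    · by_cases hq : P.q (t + 1) i j = 0
      · rw [P.xout_eq_of_q_eq_zero ht hE hq]; exact ih
      · have h1 := P.abs_sub_xout_of_q_ne_zero ht hE hq
        have h2 := P.lt_err_of_q_ne_zero ht hE hq
        have hpos : (0 : ℝ) < ((t + 1 : ℕ) : ℝ) ^ P.α := by positivity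
        have hout := P.hxoutE _ ht i j hE
        rw [P.hq _ ht i j hE] at hout
        unfold err at h1 h2
        rw [Nat.add_sub_cancel] at h1 h2 hout
        have hx := abs_le.1 (P.abs_x_le t i)
        rw [abs_le] at ih ⊢
        have hp : 0 < 1 / ((t + 1 : ℕ) : ℝ) ^ P.α := by positivity
        set h := 1 / ((t + 1 : ℕ) : ℝ) ^ P.α with hh
        have h3 := (abs_le.1 (le_of_eq h1))
        have h5 : P.xout (t + 1) i j ≤ P.xout t i j + h ∧
            P.xout t i j - h ≤ P.xout (t + 1) i j := by
          rw [hout, Rq]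
          split_ifs
          · rw [← hh]; constructor <;> linarith
          · rw [neg_div, ← hh]; constructor <;> linarith
          · rw [zero_div]; constructor <;> linarith
        rcases abs_cases (P.x t i - P.xout t i j) with ⟨h6, h7⟩ | ⟨h6, h7⟩ <;>
          rw [h6] at h2 h3 <;> constructor <;> linarith
    · rw [P.hxoutN _ ht i j hE]; exact ih

lemma err_le_two_mul (t : ℕ) (i j : Fin n) : P.err i j t ≤ 2 * normInf (P.x 0) := by
  have h1 := P.abs_xout_le t i j
  have h2 := P.abs_x_le t i
  have h3 := abs_sub (P.x t i) (P.xout t i j)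
  unfold err
  linarith

lemma drift_le {B s τ : ℕ} (hB : 0 < B) (hs : 1 ≤ s) (hsτ : s ≤ τ)
    (hW : 8 * B * Wsp (P.x 0) ≤ (s : ℝ) ^ (P.β - P.α)) (i : Fin n) :
    |P.x τ i - P.x (τ - 1) i| ≤ 1 / (16 * B) * (1 / (s : ℝ) ^ P.α) := by
  have hs0 : (0 : ℝ) < s := by exact_mod_cast hs
  have hτ0 : (0 : ℝ) < τ := by exact_mod_cast (by omega : 0 < τ)
  have hB0 : (0 : ℝ) < B := by exact_mod_cast hB
  have hβ := P.hα.trans P.hαβ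
  have hW0 : 0 ≤ Wsp (P.x 0) := by
    unfold Wsp; linarith [minV_le (P.x 0) i, le_maxV (P.x 0) i]
  refine (P.abs_x_sub_le (by omega) i).trans ?_
  have h1 : 1 / (τ : ℝ) ^ P.β ≤ 1 / (s : ℝ) ^ P.β := by
    gcongr
  have h2 : (s : ℝ) ^ P.β = (s : ℝ) ^ (P.β - P.α) * (s : ℝ) ^ P.α := by
    rw [← Real.rpow_add hs0]; congr 1; ring
  have hpa : 0 < (s : ℝ) ^ P.α := by positivity
  have hpb : 0 < (s : ℝ) ^ (P.β - P.α) := by positivity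
  calc 1 / 2 * (1 / (τ : ℝ) ^ P.β) * Wsp (P.x 0)
      ≤ 1 / 2 * (1 / (s : ℝ) ^ P.β) * Wsp (P.x 0) := by gcongr
    _ ≤ 1 / (16 * B) * (1 / (s : ℝ) ^ P.α) := by
      rw [h2, one_div_mul_one_div, one_div_mul_one_div, div_mul_eq_mul_div, one_mul,
        div_le_div_iff₀ (by positivity) (by positivity)]
      nlinarith

lemma err_add_le {B s k m : ℕ} (hB : 0 < B) (hs : 1 ≤ s) (hsk : s ≤ k)
    (hW : 8 * B * Wsp (P.x 0) ≤ (s : ℝ) ^ (P.β - P.α)) (hkm : k ≤ m) (i j : Fin n) :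
    P.err i j m ≤ P.err i j k + ((m : ℝ) - k) * (1 / (16 * B) * (1 / (s : ℝ) ^ P.α)) := by
  induction m, hkm using Nat.le_induction with
  | base => simp
  | succ m hkm ih =>
    have h1 := P.err_le_add (t := m + 1) (by omega) i j
    have h2 := P.drift_le hB hs (by omega : s ≤ m + 1) hW i
    rw [Nat.add_sub_cancel] at h1 h2
    push_cast
    linarith

lemma err_block_le {B s r : ℕ} (hB : 0 < B) (hs : 1 ≤ s)
    (hW : 8 * B * Wsp (P.x 0) ≤ (s : ℝ) ^ (P.β - P.α)) {i j : Fin n}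
    (hr : s < r) (hr' : r ≤ s + B) (hE : P.E r i j) :
    P.err i j (s + B) ≤ max (1 / (s : ℝ) ^ P.α)
      (P.err i j s - 1 / ((s + B : ℕ) : ℝ) ^ P.α) + 1 / 16 * (1 / (s : ℝ) ^ P.α) := by
  have hs0 : (0 : ℝ) < s := by exact_mod_cast hs
  have hr0 : (0 : ℝ) < r := by exact_mod_cast (by omega : 0 < r)
  have hB0 : (0 : ℝ) < B := by exact_mod_cast hB
  have hα := P.hα.le
  have h1 := P.err_add_le hB hs le_rfl hW (by omega : s ≤ r - 1) i j
  have h2 := P.err_add_le hB hs hr.le hW hr' i j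
  have h3 := P.drift_le hB hs hr.le hW i
  have h4 := P.err_le_add (t := r) (by omega) i j
  have hBd : (B : ℝ) * (1 / (16 * B) * (1 / (s : ℝ) ^ P.α)) = 1 / 16 * (1 / (s : ℝ) ^ P.α) := by
    field_simp
  have hd : 0 ≤ 1 / (16 * B) * (1 / (s : ℝ) ^ P.α) := by positivity
  set d := 1 / (16 * B) * (1 / (s : ℝ) ^ P.α)
  rw [Nat.cast_sub (by omega)] at h1
  rw [← hBd]
  push_cast at h1 h2 ⊢
  by_cases hq : P.q r i j = 0
  · have h5 : P.err i j (r - 1) ≤ 1 / (r : ℝ) ^ P.α := P.abs_le_of_q_eq_zero (by omega) hE hq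
    have h6 : 1 / (r : ℝ) ^ P.α ≤ 1 / (s : ℝ) ^ P.α := by gcongr
    have h7 : (1 : ℝ) + s ≤ r := by exact_mod_cast (by omega : 1 + s ≤ r)
    have h8 := le_max_left (1 / (s : ℝ) ^ P.α) (P.err i j s - 1 / ((s : ℝ) + B) ^ P.α)
    nlinarith
  · have h5 := P.err_le_sub (by omega) hE hq
    have h6 : 1 / ((s : ℝ) + B) ^ P.α ≤ 1 / (r : ℝ) ^ P.α := by
      have : (r : ℝ) ≤ s + B := by exact_mod_cast hr'
      gcongr
    have h8 := le_max_right (1 / (s : ℝ) ^ P.α) (P.err i j s - 1 / ((s : ℝ) + B) ^ P.α)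
    nlinarith

lemma q_eq_zero_or_q_eq_zero {B s r r' : ℕ} (hB : 0 < B) (hs : 32 * B ≤ s)
    (hW : 8 * B * Wsp (P.x 0) ≤ (s : ℝ) ^ (P.β - P.α)) {i j : Fin n}
    (herr : P.err i j s ≤ 5 / 4 * (1 / (s : ℝ) ^ P.α))
    (hr : s < r) (hrr' : r < r') (hr' : r' ≤ s + 3 * B) (hE : P.E r i j) (hE' : P.E r' i j) :
    P.q r i j = 0 ∨ P.q r' i j = 0 := by
  by_contra! h
  obtain ⟨hq, hq'⟩ := h
  have hs1 : 1 ≤ s := by omega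
  have hs0 : (0 : ℝ) < s := by exact_mod_cast hs1
  have hr0 : (0 : ℝ) < r := by exact_mod_cast (by omega : 0 < r)
  have hr0' : (0 : ℝ) < r' := by exact_mod_cast (by omega : 0 < r')
  have hB0 : (0 : ℝ) < B := by exact_mod_cast hB
  have hα := P.hα.le
  have h1 := P.err_add_le hB hs1 le_rfl hW (by omega : s ≤ r - 1) i j
  have h2 := P.err_add_le hB hs1 hr.le hW (by omega : r ≤ r' - 1) i j
  have h3 := P.drift_le hB hs1 hr.le hW i
  have h4 := P.err_le_sub (by omega) hE hq
  have h5 := P.lt_err_of_q_ne_zero (by omega) hE' hq'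
  have hBd : 3 * (B : ℝ) * (1 / (16 * B) * (1 / (s : ℝ) ^ P.α)) =
      3 / 16 * (1 / (s : ℝ) ^ P.α) := by field_simp
  have hd : 0 ≤ 1 / (16 * B) * (1 / (s : ℝ) ^ P.α) := by positivity
  set d := 1 / (16 * B) * (1 / (s : ℝ) ^ P.α)
  rw [Nat.cast_sub (by omega)] at h1 h2
  push_cast at h1 h2
  have h6 : (r' : ℝ) ≤ s + 3 * B := by exact_mod_cast hr'
  have h7 : (32 : ℝ) * B ≤ s := by exact_mod_cast hs
  have h8 : 1 / (s : ℝ) ^ P.α ≤ 35 / 32 * (1 / (r' : ℝ) ^ P.α) :=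
    inv_rpow_le_mul (P.hαβ.trans P.hβ).le hs0 (by exact_mod_cast (by omega : s ≤ r'))
      (by linarith)
  have h9 : 1 / (s : ℝ) ^ P.α ≤ 35 / 32 * (1 / (r : ℝ) ^ P.α) :=
    inv_rpow_le_mul (P.hαβ.trans P.hβ).le hs0 (by exact_mod_cast hr.le)
      (by linarith [(by exact_mod_cast hrr'.le : (r : ℝ) ≤ r')])
  have h10 : 0 < 1 / (s : ℝ) ^ P.α := by positivity
  nlinarith

lemma err_le_max {B k₀ : ℕ} (hB : 0 < B) (hk₀ : 32 ≤ k₀)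
    (hW : 8 * B * Wsp (P.x 0) ≤ ((k₀ * B : ℕ) : ℝ) ^ (P.β - P.α)) {i j : Fin n}
    (hcomm : ∀ k : ℕ, ∃ r, k * B + 1 ≤ r ∧ r ≤ (k + 1) * B ∧ P.E r i j) {k : ℕ} (hk : k₀ ≤ k) :
    P.err i j (k * B) ≤ max (5 / 4 * (1 / ((k * B : ℕ) : ℝ) ^ P.α))
      (2 * normInf (P.x 0) + (((k₀ * B : ℕ) : ℝ) ^ (1 - P.α) -
        ((k * B : ℕ) : ℝ) ^ (1 - P.α)) / (2 * B)) := by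
  have hB0 : (0 : ℝ) < B := by exact_mod_cast hB
  induction k, hk using Nat.le_induction with
  | base => exact le_max_of_le_right (by simpa using P.err_le_two_mul (k₀ * B) i j)
  | succ k hk ih =>
    obtain ⟨r, hr, hr', hE⟩ := hcomm k
    have hs1 : 1 ≤ k * B := by nlinarith
    have hs0 : (0 : ℝ) < ((k * B : ℕ) : ℝ) := by exact_mod_cast hs1
    have hW' : 8 * B * Wsp (P.x 0) ≤ ((k * B : ℕ) : ℝ) ^ (P.β - P.α) :=
      hW.trans (Real.rpow_le_rpow (by positivity) (by exact_mod_cast Nat.mul_le_mul_right B hk)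
        (by linarith [P.hαβ]))
    rw [add_mul, one_mul] at hr' ⊢
    have h1 := P.err_block_le hB hs1 hW' hr hr' hE
    have h32 : (32 : ℝ) * B ≤ ((k * B : ℕ) : ℝ) := by
      exact_mod_cast Nat.mul_le_mul_right B (hk₀.trans hk)
    have h2 : 1 / ((k * B : ℕ) : ℝ) ^ P.α ≤ 33 / 32 * (1 / ((k * B + B : ℕ) : ℝ) ^ P.α) :=
      inv_rpow_le_mul (P.hαβ.trans P.hβ).le hs0 (by push_cast; linarith)
        (by push_cast at h32 ⊢; linarith)
    have h3 := add_rpow_one_sub_le P.hα.le hs0 hB0.le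
    rw [← Nat.cast_add] at h3
    have h4 : 0 < 1 / ((k * B : ℕ) : ℝ) ^ P.α := by positivity
    set X := normInf (P.x 0)
    set H := 1 / ((k * B : ℕ) : ℝ) ^ P.α
    set H' := 1 / ((k * B + B : ℕ) : ℝ) ^ P.α
    set u := ((k * B : ℕ) : ℝ) ^ (1 - P.α)
    set u' := ((k * B + B : ℕ) : ℝ) ^ (1 - P.α)
    set u₀ := ((k₀ * B : ℕ) : ℝ) ^ (1 - P.α)
    have h5 : (u₀ - u) / (2 * B) ≤ (u₀ - u') / (2 * B) + 1 / 2 * H := by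
      rw [div_add' _ _ _ (by positivity)]
      gcongr
      nlinarith
    rcases max_choice H (P.err i j (k * B) - H') with h | h <;> rw [h] at h1
    · exact le_max_of_le_left (by linarith)
    · rcases le_max_iff.1 ih with h' | h'
      · exact le_max_of_le_left (by linarith)
      · exact le_max_of_le_right (by linarith)

lemma quietWindow_of_err_le {B k : ℕ} (hB : 0 < B) (hk : 32 ≤ k)
    (hW : 8 * B * Wsp (P.x 0) ≤ ((k * B : ℕ) : ℝ) ^ (P.β - P.α)) {Einf : Fin n → Fin n → Prop}
    (hcomm : ∀ k : ℕ, ∀ i j, Einf i j → ∃ r, k * B + 1 ≤ r ∧ r ≤ (k + 1) * B ∧ P.E r i j)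
    (herr : ∀ i j, Einf i j → P.err i j (k * B) ≤ 5 / 4 * (1 / ((k * B : ℕ) : ℝ) ^ P.α) ∧
      P.err j i (k * B) ≤ 5 / 4 * (1 / ((k * B : ℕ) : ℝ) ^ P.α)) :
    P.QuietWindow Einf (k * B) (3 * B) := by
  intro i j hij
  obtain ⟨r₁, h1, h1', hE1⟩ := hcomm k i j hij
  obtain ⟨r₂, h2, h2', hE2⟩ := hcomm (k + 1) i j hij
  obtain ⟨r₃, h3, h3', hE3⟩ := hcomm (k + 2) i j hij
  have hs : 32 * B ≤ k * B := Nat.mul_le_mul_right B hk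
  simp only [add_mul, one_mul] at h1 h1' h2 h2' h3 h3'
  obtain ⟨e1, e2⟩ := herr i j hij
  have a12 := P.q_eq_zero_or_q_eq_zero hB hs hW e1 (by omega : k * B < r₁) (by omega : r₁ < r₂)
    (by omega) hE1 hE2
  have a13 := P.q_eq_zero_or_q_eq_zero hB hs hW e1 (by omega : k * B < r₁) (by omega : r₁ < r₃)
    (by omega) hE1 hE3
  have a23 := P.q_eq_zero_or_q_eq_zero hB hs hW e1 (by omega : k * B < r₂) (by omega : r₂ < r₃)
    (by omega) hE2 hE3
  have b12 := P.q_eq_zero_or_q_eq_zero hB hs hW e2 (by omega : k * B < r₁) (by omega : r₁ < r₂)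
    (by omega) (P.Esymm _ _ _ hE1) (P.Esymm _ _ _ hE2)
  have b13 := P.q_eq_zero_or_q_eq_zero hB hs hW e2 (by omega : k * B < r₁) (by omega : r₁ < r₃)
    (by omega) (P.Esymm _ _ _ hE1) (P.Esymm _ _ _ hE3)
  have b23 := P.q_eq_zero_or_q_eq_zero hB hs hW e2 (by omega : k * B < r₂) (by omega : r₂ < r₃)
    (by omega) (P.Esymm _ _ _ hE2) (P.Esymm _ _ _ hE3)
  by_cases c1 : P.q r₁ i j = 0 ∧ P.q r₁ j i = 0
  · exact ⟨r₁, by omega, by omega, hE1, c1⟩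
  by_cases c2 : P.q r₂ i j = 0 ∧ P.q r₂ j i = 0
  · exact ⟨r₂, by omega, by omega, hE2, c2⟩
  exact ⟨r₃, by omega, by omega, hE3, by tauto, by tauto⟩

end Protocol

lemma add_rpow_le_two_mul_add_rpow {a b p : ℝ} (ha : 0 ≤ a) (hb : 0 ≤ b) (hp : 0 ≤ p) :
    a ^ p + b ^ p ≤ 2 * (a + b) ^ p := by
  have h1 : a ^ p ≤ (a + b) ^ p := Real.rpow_le_rpow ha (by linarith) hp
  have h2 : b ^ p ≤ (a + b) ^ p := Real.rpow_le_rpow hb (by linarith) hp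
  linarith

lemma mul_inv_rpow_le_of_rpow_inv_le {a N ε s t L : ℝ} (ha : 0 < a) (ha1 : a ≤ 1) (hN : 0 < N)
    (hε : 0 < ε) (hs : 0 < s) (hst : s ≤ t) (htL : t ≤ s + L) (hL : 32 * L ≤ 3 * s)
    (h : (8 * N / ε) ^ (1 / a) ≤ t) : 7 * N / s ^ a ≤ ε := by
  have ht : 0 < t := hs.trans_le hst
  have h1 : 1 / s ^ a ≤ 35 / 32 * (1 / t ^ a) := inv_rpow_le_mul ha1 hs hst (by linarith)
  have h2 := Real.rpow_le_rpow (by positivity) h ha.le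
  rw [← Real.rpow_mul (by positivity), one_div_mul_cancel ha.ne', Real.rpow_one,
    div_le_iff₀ hε] at h2
  have h3 : 8 * N * (1 / t ^ a) ≤ ε := by
    rw [mul_one_div, div_le_iff₀ (by positivity)]
    linarith
  have h4 : 0 < N * (1 / t ^ a) := by positivity
  have h5 := mul_le_mul_of_nonneg_left h1 hN.le
  rw [← mul_one_div]
  linarith

lemma rpow_div_rpow_cancel {a p : ℝ} (ha : 0 ≤ a) (hp : 0 < p) (c : ℝ) :
    (a ^ (c / p)) ^ p = a ^ c := by
  rw [← Real.rpow_mul ha, div_mul_cancel₀ _ hp.ne']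

namespace Protocol

variable {n : ℕ} (P : Protocol n)

lemma V2_le_max_of_quietWindow (hn : 1 ≤ n) {Einf : Fin n → Fin n → Prop}
    (hconn : (SimpleGraph.fromRel Einf).Connected) {Dsup : ℝ} (hD : 0 < Dsup)
    (hDsup : ∀ t i j, P.E t i j → P.D i j t ≤ Dsup) {B K : ℕ} (hB : 0 < B)
    (hquiet : ∀ k, K ≤ k → P.QuietWindow Einf (k * (3 * B)) (3 * B))
    (hK : 32 * B ≤ K * (3 * B))
    (hK' : 36 * (n : ℝ) ^ 3 * Dsup * B ≤ ((K * (3 * B) : ℕ) : ℝ) ^ (1 - P.β))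
    {k : ℕ} (hk : K ≤ k) :
    V2 (P.x (k * (3 * B))) ≤
      max (7 * (n : ℝ) ^ (1.5 : ℝ) / ((k * (3 * B) : ℕ) : ℝ) ^ P.α)
        (V2 (P.x 0) * Real.exp (-((((k + 1) * (3 * B) : ℕ) : ℝ) ^ (1 - P.β) -
          (((K + 1) * (3 * B) : ℕ) : ℝ) ^ (1 - P.β)) / (36 * (n : ℝ) ^ 3 * Dsup * B))) := by
  have hB0 : (0 : ℝ) < B := by exact_mod_cast hB
  have hn0 : (0 : ℝ) < n := by exact_mod_cast hn
  have hα := P.hα.le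
  have hβ0 := (P.hα.trans P.hαβ).le
  induction k, hk using Nat.le_induction with
  | base => exact le_max_of_le_right (by simpa using P.V2_antitone hn (Nat.zero_le _))
  | succ k hk ih =>
    have hKk : K * (3 * B) ≤ k * (3 * B) := Nat.mul_le_mul_right _ hk
    have hs1 : 1 ≤ k * (3 * B) := by omega
    have hs0 : (0 : ℝ) < ((k * (3 * B) : ℕ) : ℝ) := by exact_mod_cast hs1
    have hq := hquiet k hk
    have e1 : (k + 1) * (3 * B) = k * (3 * B) + 3 * B := by ring
    have e2 : (k + 1 + 1) * (3 * B) = k * (3 * B) + 3 * B + 3 * B := by ring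
    rw [e2]
    rw [e1] at ih ⊢
    have hs32 : 32 * (B : ℝ) ≤ ((k * (3 * B) : ℕ) : ℝ) := by exact_mod_cast hK.trans hKk
    have hle : ((k * (3 * B) : ℕ) : ℝ) ≤ ((k * (3 * B) + 3 * B : ℕ) : ℝ) := by
      exact_mod_cast Nat.le_add_right _ _
    have hadd : ((k * (3 * B) + 3 * B : ℕ) : ℝ) = ((k * (3 * B) : ℕ) : ℝ) + 3 * B := by
      push_cast; ring
    have hadd2 : ((k * (3 * B) + 3 * B + 3 * B : ℕ) : ℝ) =
        ((k * (3 * B) + 3 * B : ℕ) : ℝ) + 3 * B := by push_cast; ring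
    set u₀ := (((K + 1) * (3 * B) : ℕ) : ℝ) ^ (1 - P.β)
    have hKs : 36 * (n : ℝ) ^ 3 * Dsup * B ≤
        ((k * (3 * B) + 3 * B : ℕ) : ℝ) ^ (1 - P.β) :=
      hK'.trans (Real.rpow_le_rpow (by positivity) (by exact_mod_cast (by omega))
        (by linarith [P.hβ]))
    by_cases hV : 6 * (n : ℝ) ^ (1.5 : ℝ) / ((k * (3 * B) : ℕ) : ℝ) ^ P.α < V2 (P.x (k * (3 * B)))
    · have h := P.V2_window_le hn hconn hs1 hq hD hDsup hV
      rw [hadd2]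
      have hr0 : 0 < 1 / (12 * (n : ℝ) ^ 3 * Dsup) *
          (1 / ((k * (3 * B) + 3 * B : ℕ) : ℝ) ^ P.β) := by positivity
      have hr : 3 * (B : ℝ) / (36 * (n : ℝ) ^ 3 * Dsup * B) = 1 / (12 * (n : ℝ) ^ 3 * Dsup) := by
        field_simp; norm_num
      generalize ((k * (3 * B) + 3 * B : ℕ) : ℝ) = s' at *
      generalize ((k * (3 * B) : ℕ) : ℝ) = s at *
      have hs' : 0 < s' := hs0.trans_le hle
      have hV0 : 0 < V2 (P.x (k * (3 * B))) := lt_of_le_of_lt (by positivity) hV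
      set r := 1 / (12 * (n : ℝ) ^ 3 * Dsup) * (1 / s' ^ P.β) with hrdef
      have hr1 : 0 ≤ 1 - r := by
        by_contra! hneg
        nlinarith [V2_nonneg (P.x (k * (3 * B) + 3 * B))]
      rcases le_max_iff.1 ih with h' | h'
      · refine le_max_of_le_left (h.trans ((mul_le_mul_of_nonneg_right h' hr1).trans ?_))
        have h1 : 1 / s ^ P.α ≤ s' / s * (1 / s' ^ P.α) :=
          inv_rpow_le_mul (P.hαβ.trans P.hβ).le hs0 hle (by rw [div_mul_cancel₀ _ hs0.ne'])
        have h2 : s' / s * (1 - r) ≤ 1 := by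
          rw [div_mul_eq_mul_div, div_le_one hs0]
          have h3 : s' ^ (1 - P.β) = s' * (1 / s' ^ P.β) := by
            rw [Real.rpow_sub hs', Real.rpow_one, mul_one_div]
          have h4 : 3 * (B : ℝ) ≤ s' * r := by
            have h5 : s' * r = s' ^ (1 - P.β) * (1 / (12 * (n : ℝ) ^ 3 * Dsup)) := by
              rw [h3, hrdef]; ring
            rw [h5, mul_one_div, le_div_iff₀ (by positivity)]
            linarith
          linarith
        have h3 : 0 < 1 / s' ^ P.α := by positivity
        calc 7 * (n : ℝ) ^ (1.5 : ℝ) / s ^ P.α * (1 - r)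
            = 7 * (n : ℝ) ^ (1.5 : ℝ) * (1 / s ^ P.α * (1 - r)) := by ring
          _ ≤ 7 * (n : ℝ) ^ (1.5 : ℝ) * (1 / s' ^ P.α) := by
            gcongr
            have := mul_le_mul_of_nonneg_right h1 hr1
            nlinarith
          _ = _ := by ring
      · refine le_max_of_le_right (h.trans ((mul_le_mul_of_nonneg_right h' hr1).trans ?_))
        rw [mul_assoc]
        refine mul_le_mul_of_nonneg_left ?_ (V2_nonneg _)
        have h1 := Real.add_one_le_exp (-r)
        refine (mul_le_mul_of_nonneg_left (by linarith : 1 - r ≤ Real.exp (-r))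
          (Real.exp_pos _).le).trans ?_
        rw [← Real.exp_add, Real.exp_le_exp]
        have h2 := add_rpow_one_sub_le hβ0 hs' (by positivity : 0 ≤ 3 * (B : ℝ))
        have h3 : 3 * (B : ℝ) * (1 / s' ^ P.β) / (36 * (n : ℝ) ^ 3 * Dsup * B) = r := by
          rw [mul_div_right_comm, hr]
        have h4 := div_le_div_of_nonneg_right h2
          (by positivity : 0 ≤ 36 * (n : ℝ) ^ 3 * Dsup * B)
        rw [add_div, h3] at h4
        rw [neg_div, neg_div, sub_div, sub_div]
        linarith
    · push Not at hV
      refine le_max_of_le_left ((P.V2_antitone hn (Nat.le_add_right _ _)).trans (hV.trans ?_))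
      have h1 : 1 / ((k * (3 * B) : ℕ) : ℝ) ^ P.α ≤
          35 / 32 * (1 / ((k * (3 * B) + 3 * B : ℕ) : ℝ) ^ P.α) :=
        inv_rpow_le_mul (P.hαβ.trans P.hβ).le hs0 hle (by linarith)
      have h2 : 0 < 1 / ((k * (3 * B) : ℕ) : ℝ) ^ P.α := by positivity
      rw [← mul_one_div, ← mul_one_div (7 * _)]
      have h3 : 0 < (n : ℝ) ^ (1.5 : ℝ) := by positivity
      nlinarith

/-- After the transient, every window of three consecutive blocks is quiet. -/
lemma quietWindow_of_le {B : ℕ} (hB : 0 < B) (hn : 1 ≤ n) {Einf : Fin n → Fin n → Prop}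
    (hcomm : ∀ k : ℕ, ∀ i j, Einf i j → ∃ r, k * B + 1 ≤ r ∧ r ≤ (k + 1) * B ∧ P.E r i j)
    {T : ℝ} (hT : 32 * B ≤ T) (hTW : 8 * B * Wsp (P.x 0) ≤ T ^ (P.β - P.α)) {k : ℕ}
    (hk : (2 : ℝ) ^ ((2 : ℝ) / (1 - P.α)) * T +
      (32 * B * normInf (P.x 0)) ^ ((2 : ℝ) / (1 - P.α)) ≤ ((k * B : ℕ) : ℝ)) :
    P.QuietWindow Einf (k * B) (3 * B) := by
  have hB1 : (1 : ℝ) ≤ B := by exact_mod_cast hB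
  have hα := P.hα
  have hα1 := P.hαβ.trans P.hβ
  have hT0 : 0 < T := by linarith
  have hX : 0 ≤ normInf (P.x 0) := (abs_nonneg _).trans (abs_le_normInf (P.x 0) ⟨0, hn⟩)
  set k₀ := ⌈T / B⌉₊
  have h1 : T ≤ k₀ * B := by rw [← div_le_iff₀ (by linarith)]; exact Nat.le_ceil _
  have h2 : k₀ * B ≤ 33 / 32 * T := by
    have h := (Nat.ceil_lt_add_one (by positivity : 0 ≤ T / B)).le
    have h' : (k₀ : ℝ) * B ≤ (T / B + 1) * B := by gcongr
    rw [add_mul, div_mul_cancel₀ _ (by linarith)] at h'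
    linarith
  have hk₀ : 32 ≤ k₀ := by
    have : (32 : ℝ) * B ≤ k₀ * B := by linarith
    exact_mod_cast le_of_mul_le_mul_right this (by linarith)
  have h4 : (4 : ℝ) ≤ (2 : ℝ) ^ ((2 : ℝ) / (1 - P.α)) := by
    have h : (2 : ℝ) ≤ 2 / (1 - P.α) := by rw [le_div_iff₀ (by linarith)]; nlinarith
    have := Real.rpow_le_rpow_of_exponent_le (by norm_num : (1 : ℝ) ≤ 2) h
    norm_num at this ⊢
    exact this
  have hM : 0 ≤ (32 * B * normInf (P.x 0)) ^ ((2 : ℝ) / (1 - P.α)) := by positivity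
  have hkk : k₀ ≤ k := by
    have : (k₀ : ℝ) * B ≤ k * B := by push_cast at hk; nlinarith
    exact_mod_cast le_of_mul_le_mul_right this (by linarith)
  have hW₀ : 8 * B * Wsp (P.x 0) ≤ ((k₀ * B : ℕ) : ℝ) ^ (P.β - P.α) :=
    hTW.trans (Real.rpow_le_rpow hT0.le (by push_cast; exact h1) (by linarith [P.hαβ]))
  have hW : 8 * B * Wsp (P.x 0) ≤ ((k * B : ℕ) : ℝ) ^ (P.β - P.α) :=
    hW₀.trans (Real.rpow_le_rpow (by positivity)
      (by exact_mod_cast Nat.mul_le_mul_right B hkk) (by linarith [P.hαβ]))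
  have hcatch : 2 * normInf (P.x 0) + (((k₀ * B : ℕ) : ℝ) ^ (1 - P.α) -
      ((k * B : ℕ) : ℝ) ^ (1 - P.α)) / (2 * B) ≤ 0 := by
    set τ := T ^ (1 - P.α)
    have hτ1 : 1 ≤ τ := Real.one_le_rpow (by linarith) (by linarith)
    have h5 : ((k₀ * B : ℕ) : ℝ) ^ (1 - P.α) ≤ 33 / 32 * τ := by
      have h := Real.rpow_le_rpow (by positivity) h2 (by linarith : 0 ≤ 1 - P.α)
      rw [Real.mul_rpow (by norm_num) hT0.le] at h
      have h' := Real.rpow_le_rpow_of_exponent_le (by norm_num : (1 : ℝ) ≤ 33 / 32)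
        (by linarith : 1 - P.α ≤ 1)
      rw [Real.rpow_one] at h'
      push_cast
      exact h.trans (mul_le_mul_of_nonneg_right h' (by linarith))
    have h6 := Real.rpow_le_rpow (by positivity) hk (by linarith : 0 ≤ 1 - P.α)
    have h7 := add_rpow_le_two_mul_add_rpow
      (by positivity : 0 ≤ (2 : ℝ) ^ ((2 : ℝ) / (1 - P.α)) * T) hM (by linarith : 0 ≤ 1 - P.α)
    rw [Real.mul_rpow (by positivity) hT0.le, rpow_div_rpow_cancel (by norm_num) (by linarith),
      rpow_div_rpow_cancel (by positivity) (by linarith)] at h7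
    norm_num at h7
    rw [add_div' _ _ _ (by positivity)]
    refine div_nonpos_of_nonpos_of_nonneg ?_ (by positivity)
    nlinarith [sq_nonneg (32 * B * normInf (P.x 0) - 1 / 8)]
  have herr : ∀ i j, (∀ k : ℕ, ∃ r, k * B + 1 ≤ r ∧ r ≤ (k + 1) * B ∧ P.E r i j) →
      P.err i j (k * B) ≤ 5 / 4 * (1 / ((k * B : ℕ) : ℝ) ^ P.α) := fun i j h => by
    refine (P.err_le_max hB hk₀ hW₀ h hkk).trans (max_le le_rfl (hcatch.trans ?_))
    positivity
  refine P.quietWindow_of_err_le hB (hk₀.trans hkk) hW hcomm fun i j hij =>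
    ⟨herr i j fun k => hcomm k i j hij, herr j i fun k => ?_⟩
  obtain ⟨r, h1, h2, h3⟩ := hcomm k i j hij
  exact ⟨r, h1, h2, P.Esymm _ _ _ h3⟩

lemma exists_edge_of_connected (hn : 2 ≤ n) {Einf : Fin n → Fin n → Prop}
    (hconn : (SimpleGraph.fromRel Einf).Connected) : ∃ i j, Einf i j := by
  have : Nontrivial (Fin n) := Fin.nontrivial_iff_two_le.2 hn
  obtain ⟨j, h⟩ := hconn.preconnected.exists_adj_of_nontrivial ⟨0, by omega⟩
  rw [SimpleGraph.fromRel_adj] at h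
  rcases h.2 with h | h
  exacts [⟨_, _, h⟩, ⟨_, _, h⟩]

end Protocol

/-- the explicit convergence-time bound of the main theorem. -/
theorem stmt1_convergence_time {n : ℕ} (hn : 1 ≤ n) (P : Protocol n)
    (B : ℕ) (hB : 0 < B) (Einf : Fin n → Fin n → Prop)
    (hcore : P.CoreConnected B Einf)
    (Dsup : ℝ) (hDsup : ∀ t i j, P.E t i j → P.D i j t ≤ Dsup)
    (ε : ℝ) (hε : 0 < ε) (t : ℕ)
    (ht : (2 : ℝ) ^ ((1 : ℝ) / (1 - P.β)) *
        ((2 : ℝ) ^ ((2 : ℝ) / (1 - P.α)) *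
            ((⌈32 * (B : ℝ) + 8 * B * Wsp (P.x 0)⌉ : ℝ)) ^ ((1 : ℝ) / (P.β - P.α)) +
          (32 * B * normInf (P.x 0)) ^ ((2 : ℝ) / (1 - P.α)) + 11 * B +
          (300 * (n : ℝ) ^ 3 * Dsup * B) ^ ((1 : ℝ) / (1 - P.β))) +
        max ((150 * (n : ℝ) ^ 3 * Dsup * B * Real.log (V2 (P.x 0) / ε)) ^ ((1 : ℝ) / (1 - P.β)))
          ((8 * (n : ℝ) ^ (1.5 : ℝ) / ε) ^ ((1 : ℝ) / P.α)) ≤ (t : ℝ)) :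
    V2 (P.x t) ≤ ε := by
  rcases hn.eq_or_lt with rfl | hn2
  · simpa [V2] using hε.le
  obtain ⟨hcore₁, hconn, hcomm⟩ := hcore
  have hD : 0 < Dsup := by
    obtain ⟨i, j, hij⟩ := Protocol.exists_edge_of_connected hn2 hconn
    obtain ⟨τ, -, hE⟩ := hcore₁ i j hij
    exact (P.D_pos hE).trans_le (hDsup _ _ _ hE)
  by_cases hVε : V2 (P.x 0) ≤ ε
  · exact (P.V2_antitone hn (Nat.zero_le t)).trans hVε
  push Not at hVε
  have hV0 : 0 < V2 (P.x 0) := hε.trans hVε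
  have hlog : 0 < Real.log (V2 (P.x 0) / ε) := Real.log_pos ((one_lt_div hε).2 hVε)
  have hα := P.hα
  have hαβ := P.hαβ
  have hβ := P.hβ
  have hp : 0 < 1 - P.β := by linarith
  have hB1 : (1 : ℝ) ≤ B := by exact_mod_cast hB
  have hn0 : (0 : ℝ) < n := by positivity
  have hW0 : 0 ≤ Wsp (P.x 0) := by
    have i : Fin n := ⟨0, hn⟩
    unfold Wsp; linarith [minV_le (P.x 0) i, le_maxV (P.x 0) i]
  have hX : 0 ≤ normInf (P.x 0) := (abs_nonneg _).trans (abs_le_normInf (P.x 0) ⟨0, hn⟩)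
  have hC := Int.le_ceil (32 * (B : ℝ) + 8 * B * Wsp (P.x 0))
  set C : ℝ := (⌈32 * (B : ℝ) + 8 * B * Wsp (P.x 0)⌉ : ℝ)
  have hBW : 0 ≤ 8 * B * Wsp (P.x 0) := by positivity
  have hC1 : 1 ≤ C := by linarith
  set T := C ^ ((1 : ℝ) / (P.β - P.α))
  have hTC : C ≤ T := by
    have h : (1 : ℝ) ≤ 1 / (P.β - P.α) := by rw [le_div_iff₀ (by linarith)]; linarith
    have := Real.rpow_le_rpow_of_exponent_le hC1 h
    rwa [Real.rpow_one] at this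
  have hTW : 8 * B * Wsp (P.x 0) ≤ T ^ (P.β - P.α) := by
    rw [rpow_div_rpow_cancel (by linarith) (by linarith), Real.rpow_one]
    linarith
  set A := (2 : ℝ) ^ ((2 : ℝ) / (1 - P.α)) * T
  set Y := (32 * B * normInf (P.x 0)) ^ ((2 : ℝ) / (1 - P.α))
  set Z := (300 * (n : ℝ) ^ 3 * Dsup * B) ^ ((1 : ℝ) / (1 - P.β))
  set F := (150 * (n : ℝ) ^ 3 * Dsup * B * Real.log (V2 (P.x 0) / ε)) ^ ((1 : ℝ) / (1 - P.β))
  set Q := (8 * (n : ℝ) ^ (1.5 : ℝ) / ε) ^ ((1 : ℝ) / P.α)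
  have hY : 0 ≤ Y := by positivity
  have hZ : 0 ≤ Z := by positivity
  have hF : 0 ≤ F := by positivity
  have hQ : 0 ≤ Q := by positivity
  have hAT : T ≤ A := by
    have : (1 : ℝ) ≤ (2 : ℝ) ^ ((2 : ℝ) / (1 - P.α)) :=
      Real.one_le_rpow (by norm_num) (div_nonneg (by norm_num) (by linarith))
    nlinarith
  have h2p : (1 : ℝ) ≤ (2 : ℝ) ^ ((1 : ℝ) / (1 - P.β)) :=
    Real.one_le_rpow (by norm_num) (by positivity)
  set a := A + Y + 11 * B + Z with ha
  have ha0 : 0 ≤ a := by linarith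
  have hFt : (2 : ℝ) ^ ((1 : ℝ) / (1 - P.β)) * a + F ≤ t := by
    linarith [le_max_left F Q]
  have hQt : Q ≤ t := by nlinarith [le_max_right F Q]
  have hat : a ≤ t := by nlinarith
  have hL : (0 : ℝ) < 3 * B := by linarith
  set K := ⌈(A + Y + Z) / (3 * B)⌉₊
  have hK1 : A + Y + Z ≤ ((K * (3 * B) : ℕ) : ℝ) := by
    push_cast
    rw [← div_le_iff₀ hL]
    exact Nat.le_ceil _
  have hK2 : (((K + 1) * (3 * B) : ℕ) : ℝ) ≤ a := by
    have h : (K : ℝ) ≤ (A + Y + Z) / (3 * B) + 1 :=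
      (Nat.ceil_lt_add_one (div_nonneg (by linarith) hL.le)).le
    have h' := mul_le_mul_of_nonneg_right h hL.le
    rw [add_mul, div_mul_cancel₀ _ hL.ne'] at h'
    push_cast
    linarith
  have hK32 : 32 * B ≤ K * (3 * B) := by
    have : (32 * (B : ℝ)) ≤ ((K * (3 * B) : ℕ) : ℝ) := by linarith
    exact_mod_cast this
  set k := t / (3 * B)
  have hkt : k * (3 * B) ≤ t := Nat.div_mul_le_self _ _
  have htk : t < (k + 1) * (3 * B) := Nat.lt_mul_of_div_lt (Nat.lt_succ_self _) (by omega)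
  have hKk : K ≤ k := by
    have : (K + 1) * (3 * B) ≤ t := by exact_mod_cast hK2.trans hat
    exact (Nat.le_succ K).trans ((Nat.le_div_iff_mul_le (by omega)).2 this)
  have hquiet : ∀ l, K ≤ l → P.QuietWindow Einf (l * (3 * B)) (3 * B) := by
    intro l hl
    have e : l * (3 * B) = l * 3 * B := by ring
    rw [e]
    refine P.quietWindow_of_le hB hn hcomm (by linarith : 32 * B ≤ T) hTW ?_
    rw [← e]
    have : ((K * (3 * B) : ℕ) : ℝ) ≤ ((l * (3 * B) : ℕ) : ℝ) := by
      exact_mod_cast Nat.mul_le_mul_right _ hl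
    linarith
  have hKZ : 36 * (n : ℝ) ^ 3 * Dsup * B ≤ ((K * (3 * B) : ℕ) : ℝ) ^ (1 - P.β) := by
    have h := Real.rpow_le_rpow hZ (by linarith : Z ≤ ((K * (3 * B) : ℕ) : ℝ)) hp.le
    rw [rpow_div_rpow_cancel (by positivity) hp, Real.rpow_one] at h
    have : 0 < (n : ℝ) ^ 3 * Dsup * B := by positivity
    linarith
  refine (P.V2_antitone hn hkt).trans ?_
  refine (P.V2_le_max_of_quietWindow hn hconn hD hDsup hB hquiet hK32 hKZ hKk).trans
    (max_le ?_ ?_)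
  · have hs32 : 32 * B ≤ k * (3 * B) := hK32.trans (Nat.mul_le_mul_right _ hKk)
    have hs0 : (0 : ℝ) < ((k * (3 * B) : ℕ) : ℝ) := by exact_mod_cast (by omega)
    have h2 : (32 * (B : ℝ)) ≤ ((k * (3 * B) : ℕ) : ℝ) := by exact_mod_cast hs32
    have h3 : (t : ℝ) ≤ ((k * (3 * B) : ℕ) : ℝ) + 3 * B := by
      exact_mod_cast (by rw [add_mul, one_mul] at htk; exact htk.le)
    exact mul_inv_rpow_le_of_rpow_inv_le hα (hαβ.trans hβ).le (by positivity) hε hs0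
      (by exact_mod_cast hkt) h3 (by linarith) hQt
  · set c := 36 * (n : ℝ) ^ 3 * Dsup * B with hc
    have hc0 : 0 < c := by positivity
    have h1 := add_rpow_le_two_mul_add_rpow
      (by positivity : 0 ≤ (2 : ℝ) ^ ((1 : ℝ) / (1 - P.β)) * a) hF hp.le
    rw [Real.mul_rpow (by positivity) ha0, rpow_div_rpow_cancel (by norm_num) hp,
      rpow_div_rpow_cancel (by positivity) hp, Real.rpow_one, Real.rpow_one] at h1
    have h2 := Real.rpow_le_rpow (by positivity) hFt hp.le
    have h3 : (t : ℝ) ^ (1 - P.β) ≤ (((k + 1) * (3 * B) : ℕ) : ℝ) ^ (1 - P.β) :=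
      Real.rpow_le_rpow (by positivity) (by exact_mod_cast htk.le) hp.le
    have h4 := Real.rpow_le_rpow (by positivity) hK2 hp.le
    have h5 : Real.log (V2 (P.x 0) / ε) ≤ ((((k + 1) * (3 * B) : ℕ) : ℝ) ^ (1 - P.β) -
          (((K + 1) * (3 * B) : ℕ) : ℝ) ^ (1 - P.β)) / c := by
      rw [le_div_iff₀ hc0]
      have h6 : 150 * (n : ℝ) ^ 3 * Dsup * B * Real.log (V2 (P.x 0) / ε) =
          150 / 36 * (Real.log (V2 (P.x 0) / ε) * c) := by rw [hc]; ring
      have h7 : 0 < Real.log (V2 (P.x 0) / ε) * c := by positivity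
      linarith
    calc _ ≤ V2 (P.x 0) * Real.exp (-Real.log (V2 (P.x 0) / ε)) := by
          refine mul_le_mul_of_nonneg_left (Real.exp_le_exp.2 ?_) hV0.le
          rw [neg_div]
          linarith
      _ = ε := by
          rw [Real.exp_neg, Real.exp_log (by positivity)]
          field_simp
end
end

section
/- Under the protocol, for every t ≥ 1 and all nodes i, j with j ∈ S(i,t), one has x_j(t−1) ≠ x_i(t−1) and the weight w_{ij}(t−1) := (x̂_{i,j,in}(t) − x̂_{i,j,out}(t)) / (x_j(t−1) − x_i(t−1)) satisfies 2/3 ≤ w_{ij}(t−1) ≤ 2; consequently the update can be written as x_i(t) = x_i(t−1) + t^{−β} Σ_{j ∈ S(i,t)} (w_{ij}(t−1)/(4 D(i,j,t))) (x_j(t−1) − x_i(t−1)). -/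
open scoped Classical

noncomputable section

theorem abs_le_one_of_Rq_eq_zero {y : ℝ} (h : Rq y = 0) : |y| ≤ 1 := by
  unfold Rq at h
  split_ifs at h with h₁ h₂
  · norm_num at h
  · norm_num at h
  · exact abs_le.2 ⟨not_lt.1 h₂, not_lt.1 h₁⟩

namespace Protocol

/-- The incoming estimate for a pair is the outgoing estimate for the reversed pair. -/
theorem xin_eq_xout_swap {n : ℕ} (P : Protocol n) (t : ℕ) (i j : Fin n) :
    P.xin t i j = P.xout t j i := by
  induction t with
  | zero => rw [P.hxin0, P.hxout0]
  | succ t ih =>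
    by_cases h : P.E (t + 1) i j
    · rw [P.hxinE _ t.succ_pos _ _ h, P.hxoutE _ t.succ_pos _ _ (P.Esymm _ _ _ h),
        Nat.succ_sub_one, ih]
    · rw [P.hxinN _ t.succ_pos _ _ h,
        P.hxoutN _ t.succ_pos _ _ (fun h' => h (P.Esymm _ _ _ h')), Nat.succ_sub_one, ih]

/-- A node that sends `0` along an edge has its value within `1 / t ^ α` of the estimate. -/
theorem abs_x_sub_xout_le {n : ℕ} (P : Protocol n) {t : ℕ} (ht : 1 ≤ t) {i j : Fin n}
    (hE : P.E t i j) (hq : P.q t i j = 0) :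
    |P.x (t - 1) i - P.xout t i j| ≤ 1 / (t : ℝ) ^ P.α := by
  have hpos : 0 < (t : ℝ) ^ P.α := Real.rpow_pos_of_pos (by exact_mod_cast ht) _
  have h := abs_le_one_of_Rq_eq_zero ((P.hq t ht i j hE).symm.trans hq)
  rw [abs_mul, abs_of_pos hpos] at h
  rw [P.hxoutE t ht i j hE, hq, zero_div, add_zero, le_div_iff₀ hpos]
  linarith

end Protocol

/-- If `y` is within `2 * e` of `d` and `4 * e < |d|`, then `d / y` lies in `[2 / 3, 2]`. -/
theorem ne_zero_and_div_mem_Icc_of_abs_sub_le {d y e : ℝ} (hd : 4 * e < |d|)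
    (h : |y - d| ≤ 2 * e) : y ≠ 0 ∧ 2 / 3 ≤ d / y ∧ d / y ≤ 2 := by
  obtain ⟨h₁, h₂⟩ := abs_le.1 h
  rcases le_total 0 d with h₀ | h₀
  · rw [abs_of_nonneg h₀] at hd
    have hy : 0 < y := by linarith
    refine ⟨hy.ne', ?_, ?_⟩
    · rw [le_div_iff₀ hy]; linarith
    · rw [div_le_iff₀ hy]; linarith
  · rw [abs_of_nonpos h₀] at hd
    have hy : y < 0 := by linarith
    refine ⟨hy.ne, ?_, ?_⟩
    · rw [le_div_iff_of_neg hy]; linarith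
    · rw [div_le_iff_of_neg hy]; linarith

/-- the weights `w_{ij}(t-1)` are well defined, lie in `[2/3, 2]`, and the
update can be rewritten in terms of them. -/
theorem stmt4_weights_bounded {n : ℕ} (hn : 1 ≤ n) (P : Protocol n)
    (t : ℕ) (ht : 1 ≤ t) :
    (∀ i j : Fin n, j ∈ P.S t i →
      P.x (t - 1) j ≠ P.x (t - 1) i ∧
      2 / 3 ≤ (P.xin t i j - P.xout t i j) / (P.x (t - 1) j - P.x (t - 1) i) ∧
      (P.xin t i j - P.xout t i j) / (P.x (t - 1) j - P.x (t - 1) i) ≤ 2) ∧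
    ∀ i : Fin n, P.x t i = P.x (t - 1) i + (1 / (t : ℝ) ^ P.β) *
      ∑ j ∈ P.S t i,
        (P.xin t i j - P.xout t i j) / (P.x (t - 1) j - P.x (t - 1) i) /
            (4 * P.D i j t) * (P.x (t - 1) j - P.x (t - 1) i) := by
  have key : ∀ i j : Fin n, j ∈ P.S t i →
      P.x (t - 1) j - P.x (t - 1) i ≠ 0 ∧
      2 / 3 ≤ (P.xin t i j - P.xout t i j) / (P.x (t - 1) j - P.x (t - 1) i) ∧
      (P.xin t i j - P.xout t i j) / (P.x (t - 1) j - P.x (t - 1) i) ≤ 2 := by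
    intro i j hj
    obtain ⟨hE, hlt, hji, hij⟩ := (Finset.mem_filter.1 hj).2
    have hi := abs_le.1 (P.abs_x_sub_xout_le ht hE hij)
    have hj' := abs_le.1 (P.abs_x_sub_xout_le ht (P.Esymm _ _ _ hE) hji)
    rw [← P.xin_eq_xout_swap] at hj'
    refine ne_zero_and_div_mem_Icc_of_abs_sub_le (e := 1 / (t : ℝ) ^ P.α) ?_ ?_
    · rwa [mul_one_div]
    · exact abs_le.2 ⟨by linarith [hi.2, hj'.1], by linarith [hi.1, hj'.2]⟩
  refine ⟨fun i j hj => ⟨sub_ne_zero.1 (key i j hj).1, (key i j hj).2⟩, fun i => ?_⟩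
  rw [P.hx t ht i]
  congr 2
  refine Finset.sum_congr rfl fun j hj => ?_
  rw [div_mul_eq_mul_div, div_mul_cancel₀ _ (key i j hj).1]
end
end
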